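/- arXiv:2102.00350 — 3 statements merged into one kernel-verified Lean document; each statement's English description precedes it below -/
import Mathlib

section
/- Let n ≥ 3 be an integer, N = 2n/(n−2), c > 0 and q ∈ ((n+2)/4, n). Let τ: ℝⁿ → ℝ be a radial C¹ function with |τ(x)| ≤ C(1+|x|)^{−q}, |∂τ(x)| ≤ C(1+|x|)^{−q−1}, and lim_{r→∞} r^q |τ(r)| = c. Then there exist a radial, positive, nondecreasing (in r = |x|) C³ function φ and a C² vector field W such that (φ, τ, W) solves the vacuum conformal constraint equations, with |φ(x) − 1| ≤ C'(1+|x|)^{2−2q}, |∂φ(x)| ≤ C'(1+|x|)^{1−2q}, and the tensor k_{ij} = (τ/n) φ^{N−2} δ_{ij} + φ^{−2}(LW)_{ij} satisfies |k(x)| ≤ C'(1+|x|)^{−q}. Moreover the limit L₀ := lim_{r→∞} r^{2q−1} φ'(r) exists, is finite and positive. Consequently: lim_{r→∞} r^{n−1} φ'(r) = +∞ if q < n/2; lim_{r→∞} r^{n−1} φ'(r) ∈ (0,∞) if q = n/2; lim_{r→∞} r^{n−1} φ'(r) = 0 if q > n/2 — so that the ADM mass of g = φ^{N−2} δ_Euc,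 equal to −((n−1)/(2(n−2))) lim_{r→∞} r^{n−1} φ'(r), is respectively −∞, negative finite, or zero. -/
open scoped BigOperators
open Real Filter MeasureTheory

noncomputable section

/-- Partial derivative `∂ᵢ f (x)` on Euclidean space. -/
def pd {n : ℕ} (f : EuclideanSpace ℝ (Fin n) → ℝ) (i : Fin n)
    (x : EuclideanSpace ℝ (Fin n)) : ℝ :=
  fderiv ℝ f x (EuclideanSpace.single i 1)

/-- Euclidean Laplacian `Δ f (x) = ∑ i, ∂ᵢ∂ᵢ f (x)`. -/
def lap {n : ℕ} (f : EuclideanSpace ℝ (Fin n) → ℝ)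
    (x : EuclideanSpace ℝ (Fin n)) : ℝ :=
  ∑ i, pd (pd f i) i x

/-- Conformal Killing operator
`(LW)_{ij} = ∂ᵢ W_j + ∂_j W_i − (2 δ_{ij}/n) ∑ₖ ∂ₖ Wₖ`. -/
def cK {n : ℕ} (W : Fin n → EuclideanSpace ℝ (Fin n) → ℝ) (i j : Fin n)
    (x : EuclideanSpace ℝ (Fin n)) : ℝ :=
  pd (W j) i x + pd (W i) j x
    - (2 / (n : ℝ)) * (if i = j then (1 : ℝ) else 0) * ∑ k, pd (W k) k x

/-- The critical exponent `N = 2n/(n−2)`. -/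
def Nc (n : ℕ) : ℝ := 2 * n / ((n : ℝ) - 2)

/-- The vacuum Einstein conformal constraint equations on `ℝⁿ` (flat background,
`σ ≡ 0`): the Lichnerowicz equation together with the vector equations. -/
def SolvesCCE (n : ℕ) (φ τ : EuclideanSpace ℝ (Fin n) → ℝ)
    (W : Fin n → EuclideanSpace ℝ (Fin n) → ℝ) : Prop :=
  (∀ x, -(4 * ((n : ℝ) - 1) / ((n : ℝ) - 2)) * lap φ x
      + (((n : ℝ) - 1) / (n : ℝ)) * (τ x) ^ 2 * (φ x) ^ (Nc n - 1)
      = (∑ i, ∑ j, (cK W i j x) ^ 2) * (φ x) ^ (-(Nc n) - 1)) ∧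
  (∀ i, ∀ x, lap (W i) x
      + (((n : ℝ) - 2) / (n : ℝ)) * pd (fun y => ∑ j, pd (W j) j y) i x
      = (((n : ℝ) - 1) / (n : ℝ)) * (φ x) ^ (Nc n) * pd τ i x)

/-- The second fundamental form `k_{ij} = (τ/n) φ^{N−2} δ_{ij} + φ^{−2} (LW)_{ij}`
produced by the conformal method. -/
def kTen (n : ℕ) (φ τ : EuclideanSpace ℝ (Fin n) → ℝ)
    (W : Fin n → EuclideanSpace ℝ (Fin n) → ℝ) (i j : Fin n)
    (x : EuclideanSpace ℝ (Fin n)) : ℝ :=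
  (τ x / (n : ℝ)) * (φ x) ^ (Nc n - 2) * (if i = j then (1 : ℝ) else 0)
    + (φ x) ^ (-2 : ℝ) * cK W i j x

/-- Volterra-type equations `l = a + ∫ F l` whose right-hand side is Lipschitz with an integrable
constant have global solutions, depending in a Lipschitz way on `a`. -/
theorem exists_volterra_family {F : (ℝ → ℝ) → ℝ → ℝ} {g : ℝ → ℝ} {M : ℝ}
    (hg : Continuous g) (hg0 : ∀ s, 0 ≤ g s) (hM : ∀ r, 0 ≤ r → ∫ s in (0 : ℝ)..r, g s ≤ M)
    (hF : ∀ l, Continuous l → Continuous (F l))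
    (hFb : ∀ l, Continuous l → ∀ s, 0 ≤ s → |F l s| ≤ g s)
    (hFl : ∀ l m, Continuous l → Continuous m → ∀ s, 0 ≤ s → ∀ X,
      (∀ s' ∈ Set.Icc 0 s, |l s' - m s'| ≤ X) → |F l s - F m s| ≤ g s * X) :
    ∃ l : ℝ → ℝ → ℝ, (∀ a, Continuous (l a)) ∧
      (∀ a r, 0 ≤ r → l a r = a + ∫ s in (0 : ℝ)..r, F (l a) s) ∧
      ∃ K, ∀ a b r, 0 ≤ r → |l a r - l b r| ≤ K * |a - b| := by
  set Λ : ℝ → ℝ := fun r => ∫ s in (0 : ℝ)..r, g s with hΛ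
  have hΛd : ∀ r, HasDerivAt Λ (g r) r := fun r =>
    intervalIntegral.integral_hasDerivAt_right (hg.intervalIntegrable _ _)
      hg.stronglyMeasurable.stronglyMeasurableAtFilter hg.continuousAt
  have hΛc : Continuous Λ := continuous_iff_continuousAt.2 fun r => (hΛd r).continuousAt
  have hΛm : Monotone Λ := monotone_of_hasDerivAt_nonneg hΛd hg0
  have hΛ0 : Λ 0 = 0 := by simp [hΛ]
  have hΛpos : ∀ r, 0 ≤ r → 0 ≤ Λ r := fun r hr => hΛ0 ▸ hΛm hr
  -- the unknown is rescaled by the weight `exp (2 Λ)`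
  set w : ℝ → ℝ := fun r => exp (2 * Λ |r|) with hw
  have hwc : Continuous w := by fun_prop
  have hwpos : ∀ r, 0 < w r := fun r => exp_pos _
  have hw1 : ∀ r, 1 ≤ w r := fun r => by
    have := hΛpos |r| (abs_nonneg r)
    exact one_le_exp (by linarith)
  have hwi : ∀ r, (w r)⁻¹ ≤ 1 := fun r => inv_le_one_of_one_le₀ (hw1 r)
  have hlc : ∀ μ : BoundedContinuousFunction ℝ ℝ, Continuous fun s => w s * μ s :=
    fun μ => hwc.mul μ.continuous
  have hdist : ∀ (μ ν : BoundedContinuousFunction ℝ ℝ) (s : ℝ), |μ s - ν s| ≤ dist μ ν :=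
    fun μ ν s => (Real.dist_eq _ _).symm.trans_le (BoundedContinuousFunction.dist_coe_le_dist s)
  have hIc : ∀ l, Continuous l → Continuous fun r : ℝ => ∫ s in (0 : ℝ)..|r|, F l s := by
    intro l hl
    exact (intervalIntegral.continuous_primitive
      (fun a b => (hF l hl).intervalIntegrable a b) 0).comp continuous_abs
  have hIb : ∀ l, Continuous l → ∀ r : ℝ, |∫ s in (0 : ℝ)..|r|, F l s| ≤ M := by
    intro l hl r
    refine le_trans ?_ (hM |r| (abs_nonneg r))
    have := intervalIntegral.norm_integral_le_of_norm_le (f := F l) (g := g) (μ := volume)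
      (abs_nonneg r) (ae_of_all _ fun s hs => by
        simpa using hFb l hl s hs.1.le) (hg.intervalIntegrable _ _)
    simpa using this
  obtain ⟨T, hTapp⟩ : ∃ T : ℝ → BoundedContinuousFunction ℝ ℝ → BoundedContinuousFunction ℝ ℝ,
      ∀ a μ r, T a μ r = (w r)⁻¹ * (a + ∫ s in (0 : ℝ)..|r|, F (fun s => w s * μ s) s) := by
    refine ⟨fun a μ => BoundedContinuousFunction.ofNormedAddCommGroup
      (fun r => (w r)⁻¹ * (a + ∫ s in (0 : ℝ)..|r|, F (fun s => w s * μ s) s))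
      ((hwc.inv₀ fun r => (hwpos r).ne').mul (continuous_const.add (hIc _ (hlc μ))))
      (|a| + M) fun r => ?_, fun a μ r => rfl⟩
    rw [norm_mul, norm_inv, Real.norm_of_nonneg (hwpos r).le]
    have h1 : ‖a + ∫ s in (0 : ℝ)..|r|, F (fun s => w s * μ s) s‖ ≤ |a| + M :=
      (norm_add_le _ _).trans (add_le_add le_rfl (hIb _ (hlc μ) r))
    calc _ ≤ 1 * (|a| + M) := mul_le_mul (hwi r) h1 (norm_nonneg _) zero_le_one
      _ = _ := one_mul _
  have hT : ∀ a, ContractingWith (1 / 2) (T a) := by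
    intro a
    refine ⟨by rw [← NNReal.coe_lt_coe]; norm_num, LipschitzWith.of_dist_le_mul fun μ ν => ?_⟩
    refine (BoundedContinuousFunction.dist_le (by positivity)).2 fun r => ?_
    rw [hTapp, hTapp, Real.dist_eq, ← mul_sub, add_sub_add_left_eq_sub,
      ← intervalIntegral.integral_sub ((hF _ (hlc μ)).intervalIntegrable _ _)
        ((hF _ (hlc ν)).intervalIntegrable _ _), abs_mul, abs_of_pos (inv_pos.2 (hwpos r))]
    set X := dist μ ν
    have hX : 0 ≤ X := dist_nonneg
    have hb : |∫ s in (0 : ℝ)..|r|,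
        (F (fun s => w s * μ s) s - F (fun s => w s * ν s) s)| ≤
        ∫ s in (0 : ℝ)..|r|, g s * (exp (2 * Λ s) * X) := by
      have := intervalIntegral.norm_integral_le_of_norm_le
        (f := fun s => F (fun s => w s * μ s) s - F (fun s => w s * ν s) s)
        (g := fun s => g s * (exp (2 * Λ s) * X)) (μ := volume)
        (abs_nonneg r) (ae_of_all _ fun s hs => by
          refine hFl _ _ (hlc μ) (hlc ν) s hs.1.le _ fun s' hs' => ?_
          rw [← mul_sub, abs_mul, abs_of_pos (hwpos s')]
          refine mul_le_mul ?_ (hdist μ ν s') (abs_nonneg _)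
            (exp_pos _).le
          refine exp_le_exp.2 (mul_le_mul_of_nonneg_left (hΛm ?_) zero_le_two)
          rw [abs_of_nonneg hs'.1]; exact hs'.2)
        (Continuous.intervalIntegrable (by fun_prop) _ _)
      simpa using this
    have hval : ∫ s in (0 : ℝ)..|r|, g s * (exp (2 * Λ s) * X) = (w r - 1) / 2 * X := by
      rw [intervalIntegral.integral_eq_sub_of_hasDerivAt
        (f := fun s => exp (2 * Λ s) / 2 * X) (fun s _ => ?_)
        (Continuous.intervalIntegrable (by fun_prop) _ _)]
      · simp only [hΛ0, hw]; simp; ring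
      · have := ((((hΛd s).const_mul 2).exp).div_const 2).mul_const X
        refine this.congr_deriv ?_
        ring
    rw [hval] at hb
    calc (w r)⁻¹ * _ ≤ (w r)⁻¹ * ((w r - 1) / 2 * X) :=
          mul_le_mul_of_nonneg_left hb (inv_pos.2 (hwpos r)).le
      _ ≤ (w r)⁻¹ * (w r / 2 * X) := by
          refine mul_le_mul_of_nonneg_left ?_ (inv_pos.2 (hwpos r)).le
          refine mul_le_mul_of_nonneg_right ?_ hX
          linarith
      _ = _ := by
          have := (hwpos r).ne'
          push_cast
          field_simp
  obtain ⟨p, hp⟩ : ∃ p : ℝ → BoundedContinuousFunction ℝ ℝ, ∀ a, T a (p a) = p a :=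
    ⟨fun a => (hT a).fixedPoint, fun a => (hT a).fixedPoint_isFixedPt⟩
  have hTd : ∀ a b μ, dist (T a μ) (T b μ) ≤ |a - b| := fun a b μ => by
    refine (BoundedContinuousFunction.dist_le (abs_nonneg _)).2 fun r => ?_
    rw [hTapp, hTapp, Real.dist_eq, ← mul_sub, add_sub_add_right_eq_sub, abs_mul,
      abs_of_pos (inv_pos.2 (hwpos r))]
    exact mul_le_of_le_one_left (abs_nonneg _) (hwi r)
  have hpd : ∀ a b, dist (p a) (p b) ≤ 2 * |a - b| := fun a b => by
    have h1 := (hT a).toLipschitzWith.dist_le_mul (p a) (p b)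
    have h2 := dist_triangle (T a (p a)) (T a (p b)) (T b (p b))
    have h3 := hTd a b (p b)
    rw [hp a] at h1 h2
    rw [hp b] at h2 h3
    push_cast at h1
    linarith
  refine ⟨fun a r => w r * p a r, fun a => hlc (p a), fun a r hr => ?_,
    exp (2 * M) * 2, fun a b r hr => ?_⟩
  · have := hTapp a (p a) r
    rw [hp a, abs_of_nonneg hr] at this
    simp only
    rw [this, mul_inv_cancel_left₀ (hwpos r).ne']
  · simp only
    rw [← mul_sub, abs_mul, abs_of_pos (hwpos r), mul_assoc]
    refine mul_le_mul ?_ ((hdist _ _ r).trans (hpd a b)) (abs_nonneg _) (exp_pos _).le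
    exact exp_le_exp.2 (mul_le_mul_of_nonneg_left (hM _ (abs_nonneg r)) zero_le_two)

/-- Shooting: if moreover `F ≥ 0`, some solution of `l = a + ∫ F l` tends to `0` at infinity. -/
theorem exists_volterra_tendsto_zero {F : (ℝ → ℝ) → ℝ → ℝ} {g : ℝ → ℝ} {M : ℝ}
    (hg : Continuous g) (hg0 : ∀ s, 0 ≤ g s) (hM : ∀ r, 0 ≤ r → ∫ s in (0 : ℝ)..r, g s ≤ M)
    (hF : ∀ l, Continuous l → Continuous (F l))
    (hF0 : ∀ l s, 0 ≤ s → 0 ≤ F l s)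
    (hFb : ∀ l, Continuous l → ∀ s, 0 ≤ s → |F l s| ≤ g s)
    (hFl : ∀ l m, Continuous l → Continuous m → ∀ s, 0 ≤ s → ∀ X,
      (∀ s' ∈ Set.Icc 0 s, |l s' - m s'| ≤ X) → |F l s - F m s| ≤ g s * X) :
    ∃ l : ℝ → ℝ, Continuous l ∧ (∀ r, 0 < r → HasDerivAt l (F l r) r) ∧
      MonotoneOn l (Set.Ici 0) ∧ Tendsto l atTop (nhds 0) := by
  obtain ⟨l, hlc, hl, K, hK⟩ := exists_volterra_family hg hg0 hM hF hFb hFl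
  have hderiv : ∀ a r, 0 < r → HasDerivAt (l a) (F (l a) r) r := by
    intro a r hr
    have hc := hF _ (hlc a)
    have := (intervalIntegral.integral_hasDerivAt_right (hc.intervalIntegrable 0 r)
      hc.stronglyMeasurable.stronglyMeasurableAtFilter hc.continuousAt).const_add a
    refine this.congr_of_eventuallyEq ?_
    filter_upwards [lt_mem_nhds hr] with s hs using hl a s hs.le
  have hmono : ∀ a, MonotoneOn (l a) (Set.Ici 0) := by
    intro a
    refine monotoneOn_of_deriv_nonneg (convex_Ici 0) (hlc a).continuousOn ?_ ?_
    · intro r hr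
      rw [interior_Ici] at hr
      exact (hderiv a r hr).differentiableAt.differentiableWithinAt
    · intro r hr
      rw [interior_Ici] at hr
      rw [(hderiv a r hr).deriv]
      exact hF0 _ _ (le_of_lt hr)
  have hl0 : ∀ a, l a 0 = a := fun a => by simp [hl a 0 le_rfl]
  have hlow : ∀ a r, 0 ≤ r → a ≤ l a r := fun a r hr => by
    have := hmono a (Set.mem_Ici.2 le_rfl) (Set.mem_Ici.2 hr) hr
    rwa [hl0] at this
  have hup : ∀ a r, 0 ≤ r → l a r ≤ a + M := fun a r hr => by
    rw [hl a r hr]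
    refine add_le_add_right (le_trans ?_ (hM r hr)) a
    refine intervalIntegral.integral_mono_on hr ((hF _ (hlc a)).intervalIntegrable _ _)
      (hg.intervalIntegrable _ _) fun s hs => ?_
    exact (le_abs_self _).trans (hFb _ (hlc a) s hs.1)
  have hlim : ∀ a, ∃ L, Tendsto (l a) atTop (nhds L) := by
    intro a
    have hm : Monotone fun r : ℝ => l a (max r 0) := fun r s hrs =>
      hmono a (Set.mem_Ici.2 (le_max_right _ _)) (Set.mem_Ici.2 (le_max_right _ _))
        (max_le_max_right 0 hrs)
    have hb : BddAbove (Set.range fun r : ℝ => l a (max r 0)) := by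
      refine ⟨a + M, ?_⟩
      rintro _ ⟨r, rfl⟩
      exact hup a _ (le_max_right _ _)
    refine ⟨_, (tendsto_atTop_ciSup hm hb).congr' ?_⟩
    filter_upwards [eventually_ge_atTop 0] with r hr
    rw [max_eq_left hr]
  choose L hL using hlim
  have hLlip : ∀ a b, |L a - L b| ≤ K * |a - b| := fun a b => by
    refine le_of_tendsto ((hL a).sub (hL b)).abs ?_
    filter_upwards [eventually_ge_atTop 0] with r hr using hK a b r hr
  have hK0 : 0 ≤ K := by
    have := (abs_nonneg _).trans (hLlip 1 0)
    simpa using this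
  have hLc : Continuous L := by
    refine (LipschitzWith.of_dist_le_mul (K := K.toNNReal) fun a b => ?_).continuous
    simpa [Real.dist_eq, Real.coe_toNNReal K hK0] using hLlip a b
  have hM0 : 0 ≤ M := by simpa using hM 0 le_rfl
  have h0 : 0 ≤ L 0 := ge_of_tendsto (hL 0) (by
    filter_upwards [eventually_ge_atTop 0] with r hr using hlow 0 r hr)
  have h1 : L (-M) ≤ 0 := le_of_tendsto (hL (-M)) (by
    filter_upwards [eventually_ge_atTop 0] with r hr
    simpa using hup (-M) r hr)
  obtain ⟨a, -, ha⟩ := intermediate_value_Icc (neg_nonpos.2 hM0) hLc.continuousOn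
    (Set.mem_Icc.2 ⟨h1, h0⟩)
  exact ⟨l a, hlc a, hderiv a, hmono a, ha ▸ hL a⟩

/-- The exponential, cut off at height `1`. -/
def cutExp (x : ℝ) : ℝ := exp (min x 0)

theorem cutExp_pos (x : ℝ) : 0 < cutExp x := exp_pos _

theorem cutExp_le_one (x : ℝ) : cutExp x ≤ 1 := exp_le_one_iff.2 (min_le_right _ _)

theorem cutExp_of_nonpos {x : ℝ} (hx : x ≤ 0) : cutExp x = exp x := by
  rw [cutExp, min_eq_left hx]

theorem continuous_cutExp : Continuous cutExp := by unfold cutExp; fun_prop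

theorem abs_cutExp_sub_le (x y : ℝ) : |cutExp x - cutExp y| ≤ |x - y| := by
  have key : ∀ x y : ℝ, cutExp x - cutExp y ≤ |x - y| := by
    intro x y
    have h1 := add_one_le_exp (min y 0 - min x 0)
    have h2 : cutExp y = cutExp x * exp (min y 0 - min x 0) := by
      rw [cutExp, cutExp, ← exp_add]; ring_nf
    have h3 := abs_min_sub_min_le_max x 0 y 0
    have h4 : |min x 0 - min y 0| ≤ |x - y| := by simpa using h3
    have h5 := le_abs_self (min x 0 - min y 0)
    have h6 := cutExp_le_one x
    have h7 := cutExp_pos x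
    rw [h2]
    nlinarith [abs_nonneg (x - y)]
  rw [abs_sub_le_iff]
  exact ⟨key x y, abs_sub_comm x y ▸ key y x⟩

/-- `(√(1 + r² x²) - 1) / r²`, written so that it makes sense at `r = 0`. -/
def rootQuot (r x : ℝ) : ℝ := x ^ 2 / (1 + √(1 + r ^ 2 * x ^ 2))

theorem one_le_root (r x : ℝ) : 1 ≤ √(1 + r ^ 2 * x ^ 2) :=
  Real.one_le_sqrt.2 (by nlinarith [mul_nonneg (sq_nonneg r) (sq_nonneg x)])

theorem sq_root (r x : ℝ) : √(1 + r ^ 2 * x ^ 2) ^ 2 = 1 + r ^ 2 * x ^ 2 :=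
  Real.sq_sqrt (by positivity)

theorem rootQuot_nonneg (r x : ℝ) : 0 ≤ rootQuot r x := by unfold rootQuot; positivity

theorem root_eq (r x : ℝ) : √(1 + r ^ 2 * x ^ 2) = 1 + r ^ 2 * rootQuot r x := by
  have h1 := one_le_root r x
  have h2 := sq_root r x
  unfold rootQuot
  have : (1 + √(1 + r ^ 2 * x ^ 2)) ≠ 0 := by positivity
  field_simp
  linear_combination h2

theorem rootQuot_quadratic (r x : ℝ) :
    r ^ 2 * rootQuot r x ^ 2 + 2 * rootQuot r x = x ^ 2 := by
  have h1 := one_le_root r x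
  have h2 := sq_root r x
  unfold rootQuot
  have : (1 + √(1 + r ^ 2 * x ^ 2)) ≠ 0 := by positivity
  field_simp
  linear_combination (- x ^ 2) * h2

theorem rootQuot_le (r x : ℝ) : rootQuot r x ≤ x ^ 2 / 2 := by
  have := rootQuot_quadratic r x
  nlinarith [mul_nonneg (sq_nonneg r) (sq_nonneg (rootQuot r x))]

theorem abs_rootQuot_sub_le (r x y : ℝ) :
    |rootQuot r x - rootQuot r y| ≤ |x ^ 2 - y ^ 2| / 2 := by
  have hA := one_le_root r x
  have hB := one_le_root r y
  have hA2 := sq_root r x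
  have hB2 := sq_root r y
  unfold rootQuot
  set A := √(1 + r ^ 2 * x ^ 2)
  set B := √(1 + r ^ 2 * y ^ 2)
  have h : x ^ 2 / (1 + A) - y ^ 2 / (1 + B) = (x ^ 2 - y ^ 2) / (A + B) := by
    have h1 : 1 + A ≠ 0 := by positivity
    have h2 : 1 + B ≠ 0 := by positivity
    have h3 : A + B ≠ 0 := by positivity
    field_simp
    linear_combination x ^ 2 * hB2 - y ^ 2 * hA2
  rw [h, abs_div, abs_of_pos (show 0 < A + B by linarith)]
  exact div_le_div_of_nonneg_left (abs_nonneg _) two_pos (by linarith)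

theorem continuous_rootQuot {f g : ℝ → ℝ} (hf : Continuous f) (hg : Continuous g) :
    Continuous fun r => rootQuot (f r) (g r) := by
  unfold rootQuot
  refine Continuous.div (by fun_prop) (by fun_prop) fun r => ?_
  positivity

theorem hasDerivAt_rootQuot {x : ℝ → ℝ} {x' r : ℝ} (hr : r ≠ 0) (hx : HasDerivAt x x' r) :
    HasDerivAt (fun s => rootQuot s (x s))
      ((x r ^ 2 + r * x r * x') / (r * (1 + r ^ 2 * rootQuot r (x r)))
        - 2 * rootQuot r (x r) / r) r := by
  have hQ : HasDerivAt (fun s => √(1 + s ^ 2 * x s ^ 2))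
      ((2 * r * x r ^ 2 + r ^ 2 * (2 * x r * x')) / (2 * √(1 + r ^ 2 * x r ^ 2))) r := by
    have h := ((((hasDerivAt_id r).pow 2).mul (hx.pow 2)).const_add 1).sqrt
      (show 1 + r ^ 2 * x r ^ 2 ≠ 0 by positivity)
    refine h.congr_deriv ?_
    simp
  have h1 := (hQ.sub_const 1).div ((hasDerivAt_id r).pow 2) (by simpa using hr)
  have hpos := one_le_root r (x r)
  rw [root_eq] at hpos
  refine (h1.congr_of_eventuallyEq ?_).congr_deriv ?_
  · filter_upwards [isOpen_ne.mem_nhds hr] with s hs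
    have : s ≠ 0 := hs
    simp only [Pi.div_apply, Pi.pow_apply, id]
    rw [root_eq]
    field_simp
    ring
  · simp only [Pi.pow_apply, id, root_eq]
    have : 1 + r ^ 2 * rootQuot r (x r) ≠ 0 := by positivity
    field_simp
    ring

/-- For a continuous weight bounded by `A`, the scaled averages of a function decaying like
`r ^ (-q - 1)` decay at the same rate. -/
theorem abs_scaled_integral_le {n : ℕ} {q C A r : ℝ} {h d : ℝ → ℝ} (hqn : q < n) (hC : 0 ≤ C)
    (hdb : ∀ r, 0 ≤ r → |d r| ≤ C * (1 + r) ^ (-q - 1))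
    (hr : 0 ≤ r) (hh : ∀ s ∈ Set.Icc (0 : ℝ) 1, |h s| ≤ A) (hq : 0 ≤ q) :
    |r * ∫ s in (0 : ℝ)..1, s ^ n * h s * d (r * s)| ≤ A * (C / (n - q)) * (1 + r) ^ (-q) := by
  have hA : 0 ≤ A := (abs_nonneg _).trans (hh 0 (by simp))
  have hnq : 0 < (n : ℝ) - q := sub_pos.2 hqn
  have hb : |∫ s in (0 : ℝ)..1, s ^ n * h s * d (r * s)| ≤
      ∫ s in (0 : ℝ)..1, A * C * (1 + r) ^ (-q - 1) * s ^ ((n : ℝ) - q - 1) := by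
    have := intervalIntegral.norm_integral_le_of_norm_le
      (f := fun s => s ^ n * h s * d (r * s))
      (g := fun s => A * C * (1 + r) ^ (-q - 1) * s ^ ((n : ℝ) - q - 1)) (μ := volume)
      zero_le_one (ae_of_all _ fun s hs => ?_)
      ((intervalIntegral.intervalIntegrable_rpow' (by linarith)).const_mul _)
    · simpa using this
    · have hs0 : 0 < s := hs.1
      have h1 := hdb (r * s) (by positivity)
      have h2 : (1 + r * s) ^ (-q - 1) ≤ (s * (1 + r)) ^ (-q - 1) :=
        Real.rpow_le_rpow_of_nonpos (by positivity) (by nlinarith [hs.2]) (by linarith)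
      rw [Real.mul_rpow hs0.le (by positivity)] at h2
      have h3 : s ^ ((n : ℝ) - q - 1) = s ^ n * s ^ (-q - 1) := by
        rw [← Real.rpow_natCast, ← Real.rpow_add hs0]; ring_nf
      rw [h3, Real.norm_eq_abs, abs_mul, abs_mul, abs_of_nonneg (pow_nonneg hs0.le n)]
      calc s ^ n * |h s| * |d (r * s)|
          ≤ s ^ n * A * (C * (s ^ (-q - 1) * (1 + r) ^ (-q - 1))) := by
            refine mul_le_mul ?_ (h1.trans (mul_le_mul_of_nonneg_left h2 hC)) (abs_nonneg _)
              (by positivity)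
            exact mul_le_mul_of_nonneg_left (hh s ⟨hs0.le, hs.2⟩) (by positivity)
        _ = _ := by ring
  have hval : ∫ s in (0 : ℝ)..1, A * C * (1 + r) ^ (-q - 1) * s ^ ((n : ℝ) - q - 1) =
      A * (C / (n - q)) * (1 + r) ^ (-q - 1) := by
    rw [intervalIntegral.integral_const_mul, integral_rpow (Or.inl (by linarith))]
    rw [sub_add_cancel, Real.one_rpow, Real.zero_rpow hnq.ne']
    ring
  rw [hval] at hb
  rw [abs_mul, abs_of_nonneg hr]
  have h4 : (1 + r) ^ (-q) = (1 + r) * (1 + r) ^ (-q - 1) := by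
    rw [mul_comm, ← Real.rpow_add_one (by positivity)]; ring_nf
  have h5 : 0 ≤ A * (C / (n - q)) * (1 + r) ^ (-q - 1) := by positivity
  rw [h4]
  nlinarith

theorem continuous_one_add_abs_rpow (a : ℝ) : Continuous fun s : ℝ => (1 + |s|) ^ a :=
  Continuous.rpow_const (by fun_prop) fun s => Or.inl (by positivity)

theorem integral_one_add_rpow_le {q : ℝ} (hq : 1 < q) {r : ℝ} (hr : 0 ≤ r) :
    ∫ s in (0 : ℝ)..r, (1 + |s|) ^ (1 - 2 * q) ≤ 1 / (2 * q - 2) := by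
  have hd : ∀ s ∈ Set.uIcc 0 r, HasDerivAt (fun s : ℝ => (1 + s) ^ (2 - 2 * q) / (2 - 2 * q))
      ((1 + |s|) ^ (1 - 2 * q)) s := by
    intro s hs
    rw [Set.uIcc_of_le hr] at hs
    have h := ((((hasDerivAt_id s).const_add 1).rpow_const (p := 2 - 2 * q)
      (Or.inl (by have := hs.1; simp; positivity)))).div_const (2 - 2 * q)
    refine h.congr_deriv ?_
    rw [abs_of_nonneg hs.1]
    have : 2 - 2 * q ≠ 0 := by linarith
    rw [id, one_mul, mul_div_right_comm, div_self this, one_mul]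
    ring_nf
  rw [intervalIntegral.integral_eq_sub_of_hasDerivAt hd
    ((continuous_one_add_abs_rpow _).intervalIntegrable _ _)]
  have h1 : 0 ≤ (1 + r) ^ (2 - 2 * q) / (2 * q - 2) := by
    have : 0 < 2 * q - 2 := by linarith
    positivity
  have h2 : (1 + r) ^ (2 - 2 * q) / (2 - 2 * q) = - ((1 + r) ^ (2 - 2 * q) / (2 * q - 2)) := by
    rw [← div_neg]; ring_nf
  have h3 : (1 + 0 : ℝ) ^ (2 - 2 * q) / (2 - 2 * q) = - (1 / (2 * q - 2)) := by
    rw [← div_neg, add_zero, Real.one_rpow]; ring_nf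
  rw [h2, h3]
  linarith

/-- The scaled average `r⁻ⁿ⁻¹ ∫₀ʳ sⁿ exp (n (l s - l r)) d s ds`, with the exponential cut off. -/
def shearAvg (n : ℕ) (d l : ℝ → ℝ) (r : ℝ) : ℝ :=
  ∫ s in (0 : ℝ)..1, s ^ n * cutExp (n * (l (r * s) - l r)) * d (r * s)

/-- The right-hand side of the equation for the logarithm of the conformal factor. -/
def logFactorRHS (n : ℕ) (t d l : ℝ → ℝ) (r : ℝ) : ℝ :=
  r * rootQuot r (cutExp (l r) * ((t r - r * shearAvg n d l r) / n))

theorem continuous_shearAvg {n : ℕ} {d l : ℝ → ℝ} (hd : Continuous d) (hl : Continuous l) :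
    Continuous (shearAvg n d l) := by
  unfold shearAvg
  have := continuous_cutExp
  refine intervalIntegral.continuous_parametric_intervalIntegral_of_continuous'
    (f := fun r s => s ^ n * cutExp (n * (l (r * s) - l r)) * d (r * s)) ?_ 0 1
  simp only [Function.uncurry_def]
  fun_prop

theorem continuous_logFactorRHS {n : ℕ} {t d l : ℝ → ℝ} (ht : Continuous t) (hd : Continuous d)
    (hl : Continuous l) : Continuous (logFactorRHS n t d l) := by
  unfold logFactorRHS
  have h1 := continuous_cutExp
  have h2 := continuous_shearAvg (n := n) hd hl
  exact continuous_id.mul (continuous_rootQuot continuous_id (by fun_prop))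

section Bounds

variable {n : ℕ} {q C : ℝ} {t d : ℝ → ℝ}

theorem abs_shearAvg_le (hqn : q < n) (hC : 0 ≤ C) (hq : 0 ≤ q)
    (hdb : ∀ r, 0 ≤ r → |d r| ≤ C * (1 + r) ^ (-q - 1)) (l : ℝ → ℝ) {r : ℝ} (hr : 0 ≤ r) :
    |r * shearAvg n d l r| ≤ C / (n - q) * (1 + r) ^ (-q) := by
  have := abs_scaled_integral_le (A := 1) (h := fun s => cutExp (n * (l (r * s) - l r)))
    hqn hC hdb hr (fun s _ => by
      rw [abs_of_pos (cutExp_pos _)]; exact cutExp_le_one _) hq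
  simpa [shearAvg] using this

theorem abs_shearAvg_sub_le (hqn : q < n) (hC : 0 ≤ C) (hq : 0 ≤ q) (hd : Continuous d)
    (hdb : ∀ r, 0 ≤ r → |d r| ≤ C * (1 + r) ^ (-q - 1)) {l m : ℝ → ℝ} (hl : Continuous l)
    (hm : Continuous m) {r X : ℝ} (hr : 0 ≤ r) (hX : ∀ s ∈ Set.Icc 0 r, |l s - m s| ≤ X) :
    |r * shearAvg n d l r - r * shearAvg n d m r| ≤
      2 * n * X * (C / (n - q)) * (1 + r) ^ (-q) := by
  have hcut := continuous_cutExp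
  have := abs_scaled_integral_le (A := 2 * n * X)
    (h := fun s => cutExp (n * (l (r * s) - l r)) - cutExp (n * (m (r * s) - m r)))
    hqn hC hdb hr (fun s hs => by
      refine (abs_cutExp_sub_le _ _).trans ?_
      have h1 := hX (r * s) ⟨mul_nonneg hr hs.1, mul_le_of_le_one_right hr hs.2⟩
      have h2 := hX r ⟨hr, le_rfl⟩
      rw [← mul_sub, abs_mul, Nat.abs_cast]
      have h3 : |l (r * s) - l r - (m (r * s) - m r)| ≤ 2 * X := by
        rw [abs_le] at h1 h2 ⊢
        constructor <;> linarith [h1.1, h1.2, h2.1, h2.2]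
      nlinarith [Nat.cast_nonneg (α := ℝ) n]) hq
  refine le_of_eq_of_le ?_ this
  rw [← mul_sub, shearAvg, shearAvg, ← intervalIntegral.integral_sub
    (Continuous.intervalIntegrable (by fun_prop) _ _)
    (Continuous.intervalIntegrable (by fun_prop) _ _)]
  congr 2
  refine intervalIntegral.integral_congr fun s _ => ?_
  ring

theorem abs_div_le_of_one_le {a b : ℝ} {n : ℕ} (hn : 1 ≤ n) (h : |a| ≤ b) : |a / n| ≤ b := by
  have hn' : (1 : ℝ) ≤ n := by exact_mod_cast hn
  rw [abs_div, Nat.abs_cast]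
  exact (div_le_self (abs_nonneg a) hn').trans h

/-- Decay of the source and Lipschitz bound for the equation. -/
theorem logFactorRHS_bounds (hn : 1 ≤ n) (hqn : q < n) (hC : 0 ≤ C) (hq : 0 ≤ q)
    (hd : Continuous d)
    (htb : ∀ r, 0 ≤ r → |t r| ≤ C * (1 + r) ^ (-q))
    (hdb : ∀ r, 0 ≤ r → |d r| ≤ C * (1 + r) ^ (-q - 1)) :
    ∃ E, 0 ≤ E ∧ (∀ l, ∀ r, 0 ≤ r → |logFactorRHS n t d l r| ≤ E * (1 + |r|) ^ (1 - 2 * q)) ∧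
      ∀ l m, Continuous l → Continuous m → ∀ r, 0 ≤ r → ∀ X,
        (∀ s ∈ Set.Icc 0 r, |l s - m s| ≤ X) →
        |logFactorRHS n t d l r - logFactorRHS n t d m r| ≤
          E * (1 + |r|) ^ (1 - 2 * q) * X := by
  have hnq : 0 < (n : ℝ) - q := sub_pos.2 hqn
  set D : ℝ := C + C / (n - q) with hD
  have hD0 : 0 ≤ D := by positivity
  set D' : ℝ := D + 2 * n * (C / (n - q)) with hD'
  have hD'0 : 0 ≤ D' := by positivity
  have hpow : ∀ r : ℝ, 0 ≤ r → r * ((1 + r) ^ (-q) * (1 + r) ^ (-q)) ≤ (1 + r) ^ (1 - 2 * q) := by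
    intro r hr
    have h1 : (0 : ℝ) < 1 + r := by positivity
    rw [← Real.rpow_add h1, show 1 - 2 * q = (-q + -q) + 1 by ring, Real.rpow_add_one h1.ne']
    nlinarith [Real.rpow_pos_of_pos h1 (-q + -q)]
  have hk : ∀ l, ∀ r, 0 ≤ r → |(t r - r * shearAvg n d l r) / n| ≤ D * (1 + r) ^ (-q) := by
    intro l r hr
    refine abs_div_le_of_one_le hn ((abs_sub _ _).trans ?_)
    rw [hD, add_mul]
    exact add_le_add (htb r hr) (abs_shearAvg_le hqn hC hq hdb l hr)
  have hx : ∀ l, ∀ r, 0 ≤ r →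
      |cutExp (l r) * ((t r - r * shearAvg n d l r) / n)| ≤ D * (1 + r) ^ (-q) := by
    intro l r hr
    rw [abs_mul, abs_of_pos (cutExp_pos _)]
    exact (mul_le_of_le_one_left (abs_nonneg _) (cutExp_le_one _)).trans (hk l r hr)
  refine ⟨D * D + D * D', by positivity, fun l r hr => ?_, fun l m hl hm r hr X hX => ?_⟩
  · have hp := rootQuot_le r (cutExp (l r) * ((t r - r * shearAvg n d l r) / n))
    have hp0 := rootQuot_nonneg r (cutExp (l r) * ((t r - r * shearAvg n d l r) / n))
    have h1 := hx l r hr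
    have h2 := hpow r hr
    rw [abs_of_nonneg hr]
    unfold logFactorRHS
    rw [abs_mul, abs_of_nonneg hr, abs_of_nonneg hp0]
    set x := cutExp (l r) * ((t r - r * shearAvg n d l r) / n)
    set e := (1 + r) ^ (-q)
    have h3 : x ^ 2 ≤ (D * e) ^ 2 := sq_le_sq' (abs_le.1 h1).1 (abs_le.1 h1).2
    calc r * rootQuot r x ≤ r * (D * e) ^ 2 := by
          refine mul_le_mul_of_nonneg_left ?_ hr
          nlinarith [sq_nonneg (D * e)]
      _ = D * D * (r * (e * e)) := by ring
      _ ≤ D * D * (1 + r) ^ (1 - 2 * q) := mul_le_mul_of_nonneg_left h2 (by positivity)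
      _ ≤ _ := by
          refine mul_le_mul_of_nonneg_right ?_ (by positivity)
          nlinarith [mul_nonneg hD0 hD'0]
  · have hX0 : 0 ≤ X := (abs_nonneg _).trans (hX 0 ⟨le_rfl, hr⟩)
    have h1 := hx l r hr
    have h2 := hx m r hr
    have h3 : |cutExp (l r) * ((t r - r * shearAvg n d l r) / n)
        - cutExp (m r) * ((t r - r * shearAvg n d m r) / n)| ≤ D' * X * (1 + r) ^ (-q) := by
      have e1 : |cutExp (l r) - cutExp (m r)| ≤ X :=
        (abs_cutExp_sub_le _ _).trans (hX r ⟨hr, le_rfl⟩)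
      have e2 := hk l r hr
      have e3 : |(t r - r * shearAvg n d l r) / n - (t r - r * shearAvg n d m r) / n| ≤
          2 * n * X * (C / (n - q)) * (1 + r) ^ (-q) := by
        rw [← sub_div, sub_sub_sub_cancel_left, abs_div, abs_sub_comm, ← abs_div]
        exact abs_div_le_of_one_le hn (abs_shearAvg_sub_le hqn hC hq hd hdb hl hm hr hX)
      set k₁ := (t r - r * shearAvg n d l r) / n
      set k₂ := (t r - r * shearAvg n d m r) / n
      have e4 : cutExp (l r) * k₁ - cutExp (m r) * k₂ =
          (cutExp (l r) - cutExp (m r)) * k₁ + cutExp (m r) * (k₁ - k₂) := by ring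
      rw [e4]
      refine (abs_add_le _ _).trans ?_
      rw [abs_mul, abs_mul, abs_of_pos (cutExp_pos (m r))]
      calc _ ≤ X * (D * (1 + r) ^ (-q)) + 2 * n * X * (C / (n - q)) * (1 + r) ^ (-q) :=
            add_le_add (mul_le_mul e1 e2 (abs_nonneg _) hX0)
              ((mul_le_of_le_one_left (abs_nonneg _) (cutExp_le_one _)).trans e3)
        _ = _ := by rw [hD']; ring
    have h4 := hpow r hr
    rw [abs_of_nonneg hr]
    unfold logFactorRHS
    set x := cutExp (l r) * ((t r - r * shearAvg n d l r) / n)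
    set y := cutExp (m r) * ((t r - r * shearAvg n d m r) / n)
    set e := (1 + r) ^ (-q) with he
    have he0 : 0 < e := by positivity
    rw [← mul_sub, abs_mul, abs_of_nonneg hr]
    have h5 : |x ^ 2 - y ^ 2| ≤ (2 * (D * e)) * (D' * X * e) := by
      rw [sq_sub_sq, abs_mul]
      refine mul_le_mul ((abs_add_le _ _).trans (by linarith)) h3 (abs_nonneg _) (by positivity)
    calc r * |rootQuot r x - rootQuot r y| ≤ r * ((D * e) * (D' * X * e)) := by
          refine mul_le_mul_of_nonneg_left ((abs_rootQuot_sub_le r x y).trans ?_) hr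
          linarith
      _ = D * D' * X * (r * (e * e)) := by ring
      _ ≤ D * D' * X * (1 + r) ^ (1 - 2 * q) := mul_le_mul_of_nonneg_left h4 (by positivity)
      _ ≤ _ := by
          have : 0 ≤ D * D * X * (1 + r) ^ (1 - 2 * q) := by positivity
          linarith

end Bounds

/-- The profile of a radial solution: `l` is `2 / (n - 2)` times the logarithm of the conformal
factor, `t` the mean curvature with derivative `d`, and `r * a` the shear. -/
structure RadialProfile (n : ℕ) (t d l a : ℝ → ℝ) : Prop where
  continuous_deriv : Continuous d
  hasDerivAt_mean : ∀ r, HasDerivAt t (d r) r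
  deriv_zero : d 0 = 0
  continuous_log : Continuous l
  continuous_shear : Continuous a
  shear_zero : a 0 = 0
  hasDerivAt_log : ∀ r, 0 < r →
    HasDerivAt l (r * rootQuot r (exp (l r) * ((t r - r * a r) / n))) r
  hasDerivAt_shear : ∀ r, 0 < r → HasDerivAt a
    ((d r - (n + 1) * a r
      - n * r ^ 2 * rootQuot r (exp (l r) * ((t r - r * a r) / n)) * a r) / r) r
  log_nonpos : ∀ r, 0 ≤ r → l r ≤ 0
  tendsto_log : Tendsto l atTop (nhds 0)

theorem hasDerivAt_shearAvg {n : ℕ} {d l : ℝ → ℝ} {l' r : ℝ} (hd : Continuous d)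
    (hlc : Continuous l) (hmono : MonotoneOn l (Set.Ici 0)) (hr : 0 < r)
    (hl : HasDerivAt l l' r) :
    HasDerivAt (shearAvg n d l)
      ((d r - (n + 1) * shearAvg n d l r - n * r * l' * shearAvg n d l r) / r) r := by
  have heq : ∀ s, 0 < s → shearAvg n d l s =
      (∫ y in (0 : ℝ)..s, y ^ n * exp (n * l y) * d y) / (s ^ (n + 1) * exp (n * l s)) := by
    intro s hs
    have h1 : shearAvg n d l s = ∫ x in (0 : ℝ)..1,
        (fun y => (s ^ n * exp (n * l s))⁻¹ * (y ^ n * exp (n * l y) * d y)) (s * x) := by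
      refine intervalIntegral.integral_congr fun x hx => ?_
      rw [Set.uIcc_of_le zero_le_one] at hx
      have hle : l (s * x) ≤ l s := hmono (Set.mem_Ici.2 (mul_nonneg hs.le hx.1))
        (Set.mem_Ici.2 hs.le) (mul_le_of_le_one_right hs.le hx.2)
      simp only
      rw [cutExp_of_nonpos (mul_nonpos_of_nonneg_of_nonpos n.cast_nonneg (sub_nonpos.2 hle)),
        mul_sub, exp_sub, mul_pow]
      have := (exp_pos (n * l s)).ne'
      field_simp
    rw [h1, intervalIntegral.integral_comp_mul_left
      (fun y => (s ^ n * exp (n * l s))⁻¹ * (y ^ n * exp (n * l y) * d y)) hs.ne', mul_zero, mul_one,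
      intervalIntegral.integral_const_mul, smul_eq_mul, pow_succ]
    have := (exp_pos (n * l s)).ne'
    field_simp
  have hc : Continuous fun y => y ^ n * exp (n * l y) * d y := by fun_prop
  have hI := intervalIntegral.integral_hasDerivAt_right (hc.intervalIntegrable 0 r)
    hc.stronglyMeasurable.stronglyMeasurableAtFilter hc.continuousAt
  have hE := (hl.const_mul (n : ℝ)).exp
  have hden : HasDerivAt (fun s => s ^ (n + 1) * exp (n * l s))
      ((n + 1) * r ^ n * exp (n * l r) + r ^ (n + 1) * (exp (n * l r) * (n * l'))) r := by
    have := (hasDerivAt_pow (n + 1) r).mul hE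
    refine this.congr_deriv ?_
    push_cast
    simp
  have hne : r ^ (n + 1) * exp (n * l r) ≠ 0 := by positivity
  refine ((hI.div hden hne).congr_of_eventuallyEq ?_).congr_deriv ?_
  · filter_upwards [lt_mem_nhds hr] with s hs using heq s hs
  · rw [heq r hr]
    have := (exp_pos (n * l r)).ne'
    have := hr.ne'
    field_simp
    ring

theorem exists_radialProfile {n : ℕ} {q C : ℝ} {t d : ℝ → ℝ} (hn : 1 ≤ n) (hq : 1 < q)
    (hqn : q < n) (hC : 0 ≤ C) (hd : Continuous d) (ht : ∀ r, HasDerivAt t (d r) r)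
    (hd0 : d 0 = 0) (htb : ∀ r, 0 ≤ r → |t r| ≤ C * (1 + r) ^ (-q))
    (hdb : ∀ r, 0 ≤ r → |d r| ≤ C * (1 + r) ^ (-q - 1)) :
    ∃ l a : ℝ → ℝ, RadialProfile n t d l a ∧
      ∃ D, 0 ≤ D ∧ ∀ r, 0 ≤ r → |r * a r| ≤ D * (1 + r) ^ (-q) := by
  have hq0 : 0 ≤ q := by linarith
  have htc : Continuous t := continuous_iff_continuousAt.2 fun r => (ht r).continuousAt
  obtain ⟨E, hE, hb, hlip⟩ := logFactorRHS_bounds hn hqn hC hq0 hd htb hdb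
  obtain ⟨l, hlc, hlder, hmono, hlim⟩ := exists_volterra_tendsto_zero
    (F := logFactorRHS n t d) (g := fun s => E * (1 + |s|) ^ (1 - 2 * q))
    (M := E * (1 / (2 * q - 2)))
    (continuous_const.mul (continuous_one_add_abs_rpow _)) (fun s => by positivity)
    (fun r hr => by
      rw [intervalIntegral.integral_const_mul]
      exact mul_le_mul_of_nonneg_left (integral_one_add_rpow_le hq hr) hE)
    (fun l hl => continuous_logFactorRHS htc hd hl)
    (fun l s hs => mul_nonneg hs (rootQuot_nonneg _ _)) (fun l _ => hb l) hlip
  have hl0 : ∀ r, 0 ≤ r → l r ≤ 0 := fun r hr => by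
    refine ge_of_tendsto hlim ?_
    filter_upwards [eventually_ge_atTop r] with s hs
    exact hmono (Set.mem_Ici.2 hr) (Set.mem_Ici.2 (hr.trans hs)) hs
  have hlder' : ∀ r, 0 < r →
      HasDerivAt l (r * rootQuot r (exp (l r) * ((t r - r * shearAvg n d l r) / n))) r := by
    intro r hr
    have := hlder r hr
    rwa [logFactorRHS, cutExp_of_nonpos (hl0 r hr.le)] at this
  refine ⟨l, shearAvg n d l, ⟨hd, ht, hd0, hlc, continuous_shearAvg hd hlc, ?_, hlder', ?_, hl0,
    hlim⟩, C / (n - q), div_nonneg hC (sub_pos.2 hqn).le,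
    fun r hr => abs_shearAvg_le hqn hC hq0 hdb l hr⟩
  · simp [shearAvg, hd0]
  · intro r hr
    refine (hasDerivAt_shearAvg hd hlc hmono hr (hlder' r hr)).congr_deriv ?_
    ring

/-- The linear form with coefficients `v`. -/
def coeffForm {n : ℕ} (v : Fin n → ℝ) : EuclideanSpace ℝ (Fin n) →L[ℝ] ℝ :=
  ∑ k, v k • EuclideanSpace.proj k

/-- The direction cosines `x_k / |x|`. -/
def dirCos {n : ℕ} (k : Fin n) (x : EuclideanSpace ℝ (Fin n)) : ℝ := x k / ‖x‖

section EuclideanCalculus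

variable {n : ℕ} {F : EuclideanSpace ℝ (Fin n) → ℝ} {x : EuclideanSpace ℝ (Fin n)}

theorem coeffForm_apply (v : Fin n → ℝ) (y : EuclideanSpace ℝ (Fin n)) :
    coeffForm v y = ∑ k, v k * y k := by
  simp [coeffForm]

theorem coeffForm_single (v : Fin n → ℝ) (i : Fin n) :
    coeffForm v (EuclideanSpace.single i 1) = v i := by
  simp [coeffForm_apply]

theorem pd_eq {v : Fin n → ℝ} (h : HasFDerivAt F (coeffForm v) x) (i : Fin n) :
    pd F i x = v i := by
  rw [pd, h.fderiv, coeffForm_single]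

theorem norm_coeffForm_dirCos_le (a : ℝ) (x : EuclideanSpace ℝ (Fin n)) :
    ‖coeffForm fun k => a * dirCos k x‖ ≤ |a| := by
  refine ContinuousLinearMap.opNorm_le_bound _ (abs_nonneg _) fun y => ?_
  have h : coeffForm (fun k => a * dirCos k x) y = a / ‖x‖ * inner ℝ x y := by
    rw [coeffForm_apply, PiLp.inner_apply, Finset.mul_sum]
    refine Finset.sum_congr rfl fun k _ => ?_
    simp only [dirCos, RCLike.inner_apply, conj_trivial]
    ring
  rw [h, Real.norm_eq_abs, abs_mul, abs_div, abs_norm]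
  rcases eq_or_ne x 0 with rfl | hx
  · simp; positivity
  · have hx' : 0 < ‖x‖ := norm_pos_iff.2 hx
    calc |a| / ‖x‖ * |inner ℝ x y| ≤ |a| / ‖x‖ * (‖x‖ * ‖y‖) :=
          mul_le_mul_of_nonneg_left (abs_real_inner_le_norm x y) (by positivity)
      _ = |a| * ‖y‖ := by field_simp

/-- A continuous function whose partial derivatives exist off the origin and extend continuously
is differentiable at the origin too. -/
theorem hasFDerivAt_of_punctured {P : Fin n → EuclideanSpace ℝ (Fin n) → ℝ} (hF : Continuous F)
    (hP : ∀ k, Continuous (P k)) (h : ∀ x ≠ 0, HasFDerivAt F (coeffForm fun k => P k x) x)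
    (x : EuclideanSpace ℝ (Fin n)) : HasFDerivAt F (coeffForm fun k => P k x) x := by
  rcases eq_or_ne x 0 with rfl | hx
  swap
  · exact h x hx
  have hcont : Continuous fun y => coeffForm fun k => P k y := by
    unfold coeffForm; fun_prop
  rw [hasFDerivAt_iff_isLittleO_nhds_zero, Asymptotics.isLittleO_iff]
  intro ε hε
  obtain ⟨δ, hδ, hball⟩ := Metric.continuousAt_iff.1 (hcont.continuousAt (x := 0)) ε hε
  filter_upwards [Metric.ball_mem_nhds 0 hδ] with y hy
  rw [mem_ball_zero_iff] at hy
  rcases eq_or_ne y 0 with rfl | hy0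
  · simp
  have hder : ∀ s ∈ Set.Ioo (0 : ℝ) 1, HasDerivAt (fun s : ℝ => F (s • y))
      ((coeffForm fun k => P k (s • y)) y) s := by
    intro s hs
    have h1 : HasDerivAt (fun s : ℝ => s • y) y s := by
      simpa using (hasDerivAt_id s).smul_const y
    exact (h (s • y) (smul_ne_zero hs.1.ne' hy0)).comp_hasDerivAt s h1
  obtain ⟨s, hs, hslope⟩ := exists_hasDerivAt_eq_slope (fun s : ℝ => F (s • y)) _ zero_lt_one
    (Continuous.continuousOn (by fun_prop)) hder
  have hdist := hball (x := s • y) (by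
    rw [dist_zero_right, norm_smul, Real.norm_of_nonneg hs.1.le]
    nlinarith [norm_nonneg y, hs.2])
  simp only [one_smul, zero_smul, sub_zero, div_one] at hslope
  rw [zero_add, ← hslope, ← sub_apply]
  refine (ContinuousLinearMap.le_opNorm _ _).trans ?_
  rw [dist_eq_norm] at hdist
  exact mul_le_mul_of_nonneg_right hdist.le (norm_nonneg _)

theorem contDiff_succ_of_partials {m : ℕ} {P : Fin n → EuclideanSpace ℝ (Fin n) → ℝ}
    (h : ∀ x, HasFDerivAt F (coeffForm fun k => P k x) x) (hP : ∀ k, ContDiff ℝ m (P k)) :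
    ContDiff ℝ (m + 1) F := by
  refine contDiff_succ_iff_hasFDerivAt.2 ⟨_, ?_, h⟩
  unfold coeffForm
  exact ContDiff.sum fun k _ => (hP k).smul contDiff_const

theorem HasFDerivAt.congr_coeff {L : EuclideanSpace ℝ (Fin n) →L[ℝ] ℝ} {v : Fin n → ℝ}
    (h : HasFDerivAt F L x) (hL : ∀ k, L (EuclideanSpace.single k 1) = v k) :
    HasFDerivAt F (coeffForm v) x := by
  convert h
  ext y
  have hy : y = ∑ k, y k • EuclideanSpace.single k (1 : ℝ) := by
    ext j
    simp [Pi.single_apply]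
  rw [coeffForm_apply]
  conv_rhs => rw [hy, map_sum]
  refine Finset.sum_congr rfl fun k _ => ?_
  rw [map_smul, hL, smul_eq_mul, mul_comm]

theorem hasFDerivAt_coord (i : Fin n) (x : EuclideanSpace ℝ (Fin n)) :
    HasFDerivAt (fun y : EuclideanSpace ℝ (Fin n) => y i)
      (coeffForm fun k => if k = i then 1 else 0) x := by
  refine (EuclideanSpace.proj (𝕜 := ℝ) i).hasFDerivAt.congr_coeff fun k => ?_
  simp [eq_comm]

theorem hasFDerivAt_norm_dirCos (hx : x ≠ 0) :
    HasFDerivAt (fun y : EuclideanSpace ℝ (Fin n) => ‖y‖) (coeffForm fun k => dirCos k x) x := by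
  have hx' : 0 < ‖x‖ := norm_pos_iff.2 hx
  have h := ((hasStrictFDerivAt_norm_sq x).hasFDerivAt).sqrt (by positivity)
  refine HasFDerivAt.congr_coeff
    (h.congr_of_eventuallyEq (Eventually.of_forall fun y => ?_)) fun k => ?_
  · simp
  · simp [dirCos, EuclideanSpace.inner_single_right]
    field_simp

theorem hasFDerivAt_radial {a : ℝ → ℝ} {a' : ℝ} (hx : x ≠ 0) (ha : HasDerivAt a a' ‖x‖) :
    HasFDerivAt (fun y : EuclideanSpace ℝ (Fin n) => a ‖y‖)
      (coeffForm fun k => a' * dirCos k x) x := by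
  refine (ha.comp_hasFDerivAt x (hasFDerivAt_norm_dirCos hx)).congr_coeff fun k => ?_
  simp [coeffForm_single]

theorem HasFDerivAt.mul_coeff {G : EuclideanSpace ℝ (Fin n) → ℝ} {v w : Fin n → ℝ}
    (hF : HasFDerivAt F (coeffForm v) x) (hG : HasFDerivAt G (coeffForm w) x) :
    HasFDerivAt (fun y => F y * G y) (coeffForm fun k => F x * w k + G x * v k) x := by
  refine (hF.mul hG).congr_coeff fun k => ?_
  simp [coeffForm_single]

theorem HasFDerivAt.add_coeff {G : EuclideanSpace ℝ (Fin n) → ℝ} {v w : Fin n → ℝ}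
    (hF : HasFDerivAt F (coeffForm v) x) (hG : HasFDerivAt G (coeffForm w) x) :
    HasFDerivAt (fun y => F y + G y) (coeffForm fun k => v k + w k) x := by
  refine (hF.add hG).congr_coeff fun k => ?_
  simp [coeffForm_single]

theorem hasFDerivAt_dirCos (hx : x ≠ 0) (i : Fin n) :
    HasFDerivAt (dirCos i)
      (coeffForm fun k => ((if k = i then 1 else 0) - dirCos i x * dirCos k x) / ‖x‖) x := by
  have hx' : ‖x‖ ≠ 0 := norm_ne_zero_iff.2 hx
  have h := (hasFDerivAt_coord i x).mul_coeff (hasFDerivAt_radial hx (hasDerivAt_inv hx'))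
  refine h.congr_coeff fun k => ?_
  rw [coeffForm_single]
  simp only [dirCos]
  field_simp
  ring

theorem norm_mul_dirCos (i : Fin n) (x : EuclideanSpace ℝ (Fin n)) : ‖x‖ * dirCos i x = x i := by
  rcases eq_or_ne x 0 with rfl | hx
  · simp
  · rw [dirCos, mul_div_cancel₀ _ (norm_ne_zero_iff.2 hx)]

theorem abs_dirCos_le (i : Fin n) (x : EuclideanSpace ℝ (Fin n)) : |dirCos i x| ≤ 1 := by
  rw [dirCos, abs_div, abs_norm]
  exact div_le_one_of_le₀ (PiLp.norm_apply_le x i) (norm_nonneg _)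

theorem sum_dirCos_sq (hx : x ≠ 0) : ∑ i, dirCos i x ^ 2 = 1 := by
  have hx' : ‖x‖ ≠ 0 := norm_ne_zero_iff.2 hx
  simp only [dirCos, div_pow]
  rw [← Finset.sum_div, ← EuclideanSpace.real_norm_sq_eq, div_self (pow_ne_zero 2 hx')]

theorem continuousOn_dirCos (i : Fin n) :
    ContinuousOn (dirCos i : EuclideanSpace ℝ (Fin n) → ℝ) {0}ᶜ := by
  unfold dirCos
  exact ContinuousOn.div (by fun_prop) (by fun_prop) fun x hx => norm_ne_zero_iff.2 hx

/-- A radial function vanishing at the origin absorbs a bounded angular factor. -/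
theorem continuous_radial_mul {a : ℝ → ℝ} {b : EuclideanSpace ℝ (Fin n) → ℝ} (ha : Continuous a)
    (ha0 : a 0 = 0) (hb : ContinuousOn b {0}ᶜ) (hb1 : ∀ x, |b x| ≤ 1) :
    Continuous fun x : EuclideanSpace ℝ (Fin n) => a ‖x‖ * b x := by
  refine continuous_iff_continuousAt.2 fun x => ?_
  rcases eq_or_ne x 0 with rfl | hx
  · rw [ContinuousAt, norm_zero, ha0, zero_mul]
    have h : Tendsto (fun x : EuclideanSpace ℝ (Fin n) => |a ‖x‖|) (nhds 0) (nhds 0) := by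
      have : Continuous fun x : EuclideanSpace ℝ (Fin n) => |a ‖x‖| := by fun_prop
      simpa [ha0] using this.tendsto 0
    refine squeeze_zero_norm (fun y => ?_) h
    rw [norm_mul, Real.norm_eq_abs, Real.norm_eq_abs]
    exact mul_le_of_le_one_right (abs_nonneg _) (hb1 y)
  · exact (ha.comp continuous_norm).continuousAt.mul
      (hb.continuousAt (isOpen_compl_singleton.mem_nhds hx))

theorem continuous_radial_mul_dirCos {a : ℝ → ℝ} (ha : Continuous a) (ha0 : a 0 = 0)
    (i : Fin n) : Continuous fun x : EuclideanSpace ℝ (Fin n) => a ‖x‖ * dirCos i x :=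
  continuous_radial_mul ha ha0 (continuousOn_dirCos i) (abs_dirCos_le i)

theorem continuous_radial_mul_dirCos₂ {a : ℝ → ℝ} (ha : Continuous a) (ha0 : a 0 = 0)
    (i j : Fin n) :
    Continuous fun x : EuclideanSpace ℝ (Fin n) => a ‖x‖ * (dirCos i x * dirCos j x) :=
  continuous_radial_mul ha ha0 ((continuousOn_dirCos i).mul (continuousOn_dirCos j)) fun x => by
    rw [abs_mul]
    exact mul_le_one₀ (abs_dirCos_le i x) (abs_nonneg _) (abs_dirCos_le j x)

theorem continuous_radial_mul_dirCos₃ {a : ℝ → ℝ} (ha : Continuous a) (ha0 : a 0 = 0)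
    (i j k : Fin n) :
    Continuous fun x : EuclideanSpace ℝ (Fin n) =>
      a ‖x‖ * (dirCos i x * dirCos j x * dirCos k x) :=
  continuous_radial_mul ha ha0 (((continuousOn_dirCos i).mul (continuousOn_dirCos j)).mul
    (continuousOn_dirCos k)) fun x => by
    rw [abs_mul, abs_mul]
    exact mul_le_one₀ (mul_le_one₀ (abs_dirCos_le i x) (abs_nonneg _) (abs_dirCos_le j x))
      (abs_nonneg _) (abs_dirCos_le k x)

/-- First derivative of a radial function whose radial derivative vanishes at the origin. -/
theorem hasFDerivAt_radial_everywhere {a a₁ : ℝ → ℝ} (ha : Continuous a) (ha₁ : Continuous a₁)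
    (ha₁0 : a₁ 0 = 0) (hd : ∀ r, 0 < r → HasDerivAt a (a₁ r) r)
    (x : EuclideanSpace ℝ (Fin n)) :
    HasFDerivAt (fun y : EuclideanSpace ℝ (Fin n) => a ‖y‖)
      (coeffForm fun k => a₁ ‖x‖ * dirCos k x) x :=
  hasFDerivAt_of_punctured (P := fun k x => a₁ ‖x‖ * dirCos k x) (by fun_prop)
    (fun k => continuous_radial_mul_dirCos ha₁ ha₁0 k)
    (fun x hx => hasFDerivAt_radial hx (hd _ (norm_pos_iff.2 hx))) x

/-- A radial profile `g` with first derivative `g₁` and second derivative `g₂ / r` off the origin,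
regular enough for the radial vector field `g(|x|) x` to be `C²`. -/
structure RadialC2 (g g₁ g₂ : ℝ → ℝ) : Prop where
  continuous₀ : Continuous g
  continuous₁ : Continuous g₁
  continuous₂ : Continuous g₂
  zero₁ : g₁ 0 = 0
  zero₂ : g₂ 0 = 0
  hasDerivAt₀ : ∀ r, 0 < r → HasDerivAt g (g₁ r) r
  hasDerivAt₁ : ∀ r, 0 < r → HasDerivAt g₁ (g₂ r / r) r

/-- The Jacobian of the radial vector field `g(|x|) x`. -/
def radialJac (g g₁ : ℝ → ℝ) (i j : Fin n) (x : EuclideanSpace ℝ (Fin n)) : ℝ :=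
  (if j = i then 1 else 0) * g ‖x‖ + (‖x‖ * g₁ ‖x‖) * (dirCos i x * dirCos j x)

/-- The second partial derivatives of the radial vector field `g(|x|) x`. -/
def radialHess (g₁ g₂ : ℝ → ℝ) (i j k : Fin n) (x : EuclideanSpace ℝ (Fin n)) : ℝ :=
  (if j = i then 1 else 0) * (g₁ ‖x‖ * dirCos k x)
    + (if k = i then 1 else 0) * (g₁ ‖x‖ * dirCos j x)
    + (if k = j then 1 else 0) * (g₁ ‖x‖ * dirCos i x)
    + (g₂ ‖x‖ - g₁ ‖x‖) * (dirCos i x * dirCos j x * dirCos k x)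

variable {g g₁ g₂ : ℝ → ℝ}

theorem RadialC2.continuous_radialJac (h : RadialC2 g g₁ g₂) (i j : Fin n) :
    Continuous (radialJac g g₁ i j) := by
  have h0 := h.continuous₀
  have h1 := h.continuous₁
  unfold radialJac
  exact Continuous.add (by fun_prop)
    (continuous_radial_mul_dirCos₂ (a := fun r => r * g₁ r) (by fun_prop) (by simp) i j)

theorem RadialC2.continuous_radialHess (h : RadialC2 g g₁ g₂) (i j k : Fin n) :
    Continuous (radialHess g₁ g₂ i j k) := by
  have h1 := continuous_radial_mul_dirCos (n := n) h.continuous₁ h.zero₁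
  have h2 := continuous_radial_mul_dirCos₃ (a := fun r => g₂ r - g₁ r)
    (h.continuous₂.sub h.continuous₁) (by simp [h.zero₁, h.zero₂]) i j k
  unfold radialHess
  exact (((continuous_const.mul (h1 k)).add (continuous_const.mul (h1 j))).add
    (continuous_const.mul (h1 i))).add h2

theorem RadialC2.hasFDerivAt (h : RadialC2 g g₁ g₂) (i : Fin n) (x : EuclideanSpace ℝ (Fin n)) :
    HasFDerivAt (fun y : EuclideanSpace ℝ (Fin n) => g ‖y‖ * y i)
      (coeffForm fun j => radialJac g g₁ i j x) x := by
  have h0 := h.continuous₀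
  refine hasFDerivAt_of_punctured (P := fun j x => radialJac g g₁ i j x) (by fun_prop)
    (h.continuous_radialJac i) (fun x hx => ?_) x
  have h1 := (hasFDerivAt_radial hx (h.hasDerivAt₀ _ (norm_pos_iff.2 hx))).mul_coeff
    (hasFDerivAt_coord i x)
  refine h1.congr_coeff fun j => ?_
  rw [coeffForm_single, radialJac, ← norm_mul_dirCos i x]
  ring

theorem RadialC2.hasFDerivAt_radialJac (h : RadialC2 g g₁ g₂) (i j : Fin n)
    (x : EuclideanSpace ℝ (Fin n)) :
    HasFDerivAt (radialJac g g₁ i j) (coeffForm fun k => radialHess g₁ g₂ i j k x) x := by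
  refine hasFDerivAt_of_punctured (P := fun k x => radialHess g₁ g₂ i j k x)
    (h.continuous_radialJac i j) (h.continuous_radialHess i j) (fun x hx => ?_) x
  have hx' : 0 < ‖x‖ := norm_pos_iff.2 hx
  have h1 := hasFDerivAt_radial hx ((h.hasDerivAt₀ _ hx').const_mul (if j = i then (1 : ℝ) else 0))
  have h2 := hasFDerivAt_radial hx ((hasDerivAt_id _).mul (h.hasDerivAt₁ _ hx'))
  have h3 := (hasFDerivAt_dirCos hx i).mul_coeff (hasFDerivAt_dirCos hx j)
  refine (h1.add_coeff (h2.mul_coeff h3)).congr_coeff fun k => ?_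
  rw [coeffForm_single, radialHess]
  simp only [Pi.mul_apply, id]
  field_simp
  ring

theorem RadialC2.contDiff (h : RadialC2 g g₁ g₂) (i : Fin n) :
    ContDiff ℝ 2 fun y : EuclideanSpace ℝ (Fin n) => g ‖y‖ * y i := by
  have h1 : ∀ j, ContDiff ℝ 1 (radialJac g g₁ i j : EuclideanSpace ℝ (Fin n) → ℝ) := fun j => by
    have := contDiff_succ_of_partials (m := 0) (h.hasFDerivAt_radialJac (n := n) i j)
      fun k => contDiff_zero.2 (h.continuous_radialHess i j k)
    simpa using this
  exact_mod_cast contDiff_succ_of_partials (m := 1) (h.hasFDerivAt i) h1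

end EuclideanCalculus

namespace RadialProfile

variable {n : ℕ} {t d l a : ℝ → ℝ}

/-- The trace-free-gradient quantity `exp l * (t - r a) / n`. -/
def slope (n : ℕ) (t l a : ℝ → ℝ) (r : ℝ) : ℝ := exp (l r) * ((t r - r * a r) / n)

/-- The logarithmic derivative of the conformal factor, divided by `r`. -/
def rate (n : ℕ) (t l a : ℝ → ℝ) (r : ℝ) : ℝ := rootQuot r (slope n t l a r)

theorem continuous_mean (h : RadialProfile n t d l a) : Continuous t :=
  continuous_iff_continuousAt.2 fun r => (h.hasDerivAt_mean r).continuousAt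

theorem continuous_slope (h : RadialProfile n t d l a) : Continuous (slope n t l a) := by
  have h1 := h.continuous_mean
  have h2 := h.continuous_log
  have h3 := h.continuous_shear
  unfold slope
  fun_prop

theorem continuous_rate (h : RadialProfile n t d l a) : Continuous (rate n t l a) :=
  continuous_rootQuot continuous_id h.continuous_slope

theorem rate_nonneg (r : ℝ) : 0 ≤ rate n t l a r := rootQuot_nonneg _ _

theorem rate_quadratic (r : ℝ) :
    r ^ 2 * rate n t l a r ^ 2 + 2 * rate n t l a r = slope n t l a r ^ 2 :=
  rootQuot_quadratic _ _

theorem hasDerivAt_quot (hn : 1 ≤ n) (h : RadialProfile n t d l a) {r : ℝ} (hr : 0 < r) :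
    HasDerivAt (fun r => (t r - r * a r) / n) (a r * (1 + r ^ 2 * rate n t l a r)) r := by
  have hn0 : (n : ℝ) ≠ 0 := by positivity
  refine (((h.hasDerivAt_mean r).sub ((hasDerivAt_id r).mul
    (h.hasDerivAt_shear r hr))).div_const (n : ℝ)).congr_deriv ?_
  simp only [id, rate, slope]
  field_simp
  ring

theorem hasDerivAt_slope (hn : 1 ≤ n) (h : RadialProfile n t d l a) {r : ℝ} (hr : 0 < r) :
    HasDerivAt (slope n t l a) (r * rate n t l a r * slope n t l a r
      + exp (l r) * (a r * (1 + r ^ 2 * rate n t l a r))) r := by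
  refine ((h.hasDerivAt_log r hr).exp.mul (hasDerivAt_quot hn h hr)).congr_deriv ?_
  simp only [rate, slope]
  ring

theorem hasDerivAt_rate (hn : 1 ≤ n) (h : RadialProfile n t d l a) {r : ℝ} (hr : 0 < r) :
    HasDerivAt (rate n t l a)
      (r * rate n t l a r ^ 2 + slope n t l a r * exp (l r) * a r) r := by
  refine (hasDerivAt_rootQuot hr.ne' (hasDerivAt_slope hn h hr)).congr_deriv ?_
  change _ / (r * (1 + r ^ 2 * rate n t l a r)) - 2 * rate n t l a r / r = _
  have h1 : 1 + r ^ 2 * rate n t l a r ≠ 0 := by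
    have := rate_nonneg (n := n) (t := t) (l := l) (a := a) r
    positivity
  have h2 := rate_quadratic (n := n) (t := t) (l := l) (a := a) r
  field_simp
  linear_combination (-(1 + r ^ 2 * rate n t l a r)) * h2

/-- The profile `f` of the vector field `W = f(|x|) x`. -/
theorem radialC2_vector (h : RadialProfile n t d l a) :
    RadialC2 (fun r => ∫ s in (0 : ℝ)..r, exp (n * l s) / 2 * a s)
      (fun r => exp (n * l r) / 2 * a r)
      (fun r => exp (n * l r) / 2 * (d r - (n + 1) * a r)) := by
  have hl := h.continuous_log
  have ha := h.continuous_shear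
  have hd := h.continuous_deriv
  have hc : Continuous fun r => exp (n * l r) / 2 * a r := by fun_prop
  have hder : ∀ r, HasDerivAt (fun r => ∫ s in (0 : ℝ)..r, exp (n * l s) / 2 * a s)
      (exp (n * l r) / 2 * a r) r := fun r =>
    intervalIntegral.integral_hasDerivAt_right (hc.intervalIntegrable _ _)
      hc.stronglyMeasurable.stronglyMeasurableAtFilter hc.continuousAt
  refine ⟨continuous_iff_continuousAt.2 fun r => (hder r).continuousAt, hc, by fun_prop,
    by simp [h.shear_zero], by simp [h.shear_zero, h.deriv_zero], fun r _ => hder r,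
    fun r hr => ?_⟩
  refine ((((h.hasDerivAt_log r hr).const_mul (n : ℝ)).exp.div_const 2).mul
    (h.hasDerivAt_shear r hr)).congr_deriv ?_
  field_simp
  ring

/-- The profile `ψ` with `∇φ = ψ(|x|) x`, where `φ = exp (b l)`. -/
theorem radialC2_gradient (hn : 1 ≤ n) (h : RadialProfile n t d l a) (b : ℝ) :
    ∃ ψ₂, RadialC2 (fun r => b * exp (b * l r) * rate n t l a r)
      (fun r => b * exp (b * l r) * ((1 + b) * (r * rate n t l a r ^ 2)
        + slope n t l a r * exp (l r) * a r)) ψ₂ := by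
  have hl := h.continuous_log
  have ha := h.continuous_shear
  have hd := h.continuous_deriv
  have hs := h.continuous_slope
  have hp := h.continuous_rate
  set p := rate n t l a with hpdef
  set x := slope n t l a with hxdef
  refine ⟨fun r => b * exp (b * l r) *
    (r * (b * r * p r * ((1 + b) * (r * p r ^ 2) + x r * exp (l r) * a r)
      + (1 + b) * (p r ^ 2 + 2 * r * p r * (r * p r ^ 2 + x r * exp (l r) * a r))
      + (r * p r * x r + exp (l r) * (a r * (1 + r ^ 2 * p r))) * exp (l r) * a r
      + x r * exp (l r) * (r * p r) * a r)
      + x r * exp (l r) * (d r - (n + 1) * a r - n * r ^ 2 * p r * a r)),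
    by fun_prop, by fun_prop, by fun_prop, by simp [h.shear_zero],
    by simp [h.shear_zero, h.deriv_zero], fun r hr => ?_, fun r hr => ?_⟩
  · have hl' : HasDerivAt l (r * p r) r := h.hasDerivAt_log r hr
    have hp' := hasDerivAt_rate hn h hr
    refine (((hl'.const_mul b).exp.const_mul b).mul hp').congr_deriv ?_
    simp only [← hpdef, ← hxdef]
    ring
  · have hl' : HasDerivAt l (r * p r) r := h.hasDerivAt_log r hr
    have ha' : HasDerivAt a ((d r - (n + 1) * a r - n * r ^ 2 * p r * a r) / r) r :=
      h.hasDerivAt_shear r hr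
    have hp' := hasDerivAt_rate hn h hr
    have hx' := hasDerivAt_slope hn h hr
    rw [← hpdef, ← hxdef] at hp' hx'
    refine (((hl'.const_mul b).exp.const_mul b).mul
      ((((hasDerivAt_id r).mul (hp'.pow 2)).const_mul (1 + b)).add
        ((hx'.mul hl'.exp).mul ha'))).congr_deriv ?_
    simp only [Pi.add_apply, Pi.mul_apply, Pi.pow_apply, id]
    field_simp
    ring

/-- The algebraic identity behind the Lichnerowicz equation. -/
theorem laplace_identity (hn : 1 ≤ n) (b : ℝ) (hb : 1 + b = n / 2) (r : ℝ) :
    n * (b * exp (b * l r) * rate n t l a r) + r * (b * exp (b * l r) *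
      ((1 + b) * (r * rate n t l a r ^ 2) + slope n t l a r * exp (l r) * a r)) =
    b / (2 * n) * (exp (b * l r) * exp (l r) ^ 2) * (t r ^ 2 - (r * a r) ^ 2) := by
  have hn0 : (n : ℝ) ≠ 0 := by positivity
  have h1 := rate_quadratic (n := n) (t := t) (l := l) (a := a) r
  have h2 : slope n t l a r = exp (l r) * ((t r - r * a r) / n) := rfl
  rw [hb]
  set p := rate n t l a r
  calc _ = b * exp (b * l r) * (n / 2 * (r ^ 2 * p ^ 2 + 2 * p)
        + slope n t l a r * exp (l r) * (r * a r)) := by ring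
    _ = _ := by
      rw [h1, h2]
      field_simp
      ring

theorem hasDerivAt_factor (h : RadialProfile n t d l a) (b : ℝ) {r : ℝ} (hr : 0 < r) :
    HasDerivAt (fun r => exp (b * l r)) (r * (b * exp (b * l r) * rate n t l a r)) r := by
  refine ((h.hasDerivAt_log r hr).const_mul b).exp.congr_deriv ?_
  simp only [rate, slope]
  ring

theorem monotoneOn_factor (h : RadialProfile n t d l a) {b : ℝ} (hb : 0 ≤ b) :
    MonotoneOn (fun r => exp (b * l r)) (Set.Ici 0) := by
  have hl := h.continuous_log
  refine monotoneOn_of_deriv_nonneg (convex_Ici 0) (Continuous.continuousOn (by fun_prop)) ?_ ?_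
  · intro r hr
    rw [interior_Ici] at hr
    exact (h.hasDerivAt_factor b hr).differentiableAt.differentiableWithinAt
  · intro r hr
    rw [interior_Ici] at hr
    rw [(h.hasDerivAt_factor b hr).deriv]
    have := rate_nonneg (n := n) (t := t) (l := l) (a := a) r
    have hr' : 0 < r := hr
    positivity

theorem exp_mul_log_le_one (h : RadialProfile n t d l a) {b : ℝ} (hb : 0 ≤ b) {r : ℝ}
    (hr : 0 ≤ r) : exp (b * l r) ≤ 1 :=
  exp_le_one_iff.2 (mul_nonpos_of_nonneg_of_nonpos hb (h.log_nonpos r hr))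

theorem tendsto_exp_mul_log (h : RadialProfile n t d l a) (b : ℝ) :
    Tendsto (fun r => exp (b * l r)) atTop (nhds 1) := by
  simpa using (h.tendsto_log.const_mul b).rexp

section Decay

variable {q C D : ℝ}

theorem abs_slope_le (hn : 1 ≤ n) (h : RadialProfile n t d l a)
    (htb : ∀ r, 0 ≤ r → |t r| ≤ C * (1 + r) ^ (-q))
    (hab : ∀ r, 0 ≤ r → |r * a r| ≤ D * (1 + r) ^ (-q)) {r : ℝ} (hr : 0 ≤ r) :
    |slope n t l a r| ≤ (C + D) * (1 + r) ^ (-q) := by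
  rw [slope, abs_mul, abs_of_pos (exp_pos _)]
  refine (mul_le_of_le_one_left (abs_nonneg _) (exp_le_one_iff.2 (h.log_nonpos r hr))).trans ?_
  refine abs_div_le_of_one_le hn ((abs_sub _ _).trans ?_)
  rw [add_mul]
  exact add_le_add (htb r hr) (hab r hr)

theorem rate_le (hn : 1 ≤ n) (h : RadialProfile n t d l a)
    (htb : ∀ r, 0 ≤ r → |t r| ≤ C * (1 + r) ^ (-q))
    (hab : ∀ r, 0 ≤ r → |r * a r| ≤ D * (1 + r) ^ (-q)) {r : ℝ} (hr : 0 ≤ r) :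
    rate n t l a r ≤ (C + D) ^ 2 / 2 * (1 + r) ^ (-2 * q) := by
  have h1 := abs_slope_le hn h htb hab hr
  have h2 := rootQuot_le r (slope n t l a r)
  have h3 := sq_le_sq' (abs_le.1 h1).1 (abs_le.1 h1).2
  have h4 : (1 + r) ^ (-2 * q) = ((1 + r) ^ (-q)) ^ 2 := by
    rw [← Real.rpow_mul_natCast (by positivity)]; push_cast; ring_nf
  rw [rate, h4]
  nlinarith

theorem abs_factor_deriv_le (hn : 1 ≤ n) (h : RadialProfile n t d l a) {b : ℝ} (hb : 0 ≤ b)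
    (htb : ∀ r, 0 ≤ r → |t r| ≤ C * (1 + r) ^ (-q))
    (hab : ∀ r, 0 ≤ r → |r * a r| ≤ D * (1 + r) ^ (-q)) {r : ℝ} (hr : 0 ≤ r) :
    |r * (b * exp (b * l r) * rate n t l a r)| ≤
      b * ((C + D) ^ 2 / 2) * (1 + r) ^ (1 - 2 * q) := by
  have h1 := rate_le hn h htb hab hr
  have h0 := rate_nonneg (n := n) (t := t) (l := l) (a := a) r
  have h2 := h.exp_mul_log_le_one hb hr
  have h3 : (1 + r) ^ (1 - 2 * q) = (1 + r) * (1 + r) ^ (-2 * q) := by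
    rw [show 1 - 2 * q = -2 * q + 1 by ring, Real.rpow_add_one (by positivity), mul_comm]
  rw [abs_of_nonneg (by positivity), h3]
  set e := (1 + r) ^ (-2 * q)
  have he : 0 ≤ e := by positivity
  calc r * (b * exp (b * l r) * rate n t l a r)
      ≤ (1 + r) * (b * 1 * ((C + D) ^ 2 / 2 * e)) := by gcongr; linarith
    _ = _ := by ring

theorem abs_factor_sub_one_le (hn : 1 ≤ n) (h : RadialProfile n t d l a) {b : ℝ} (hb : 0 ≤ b)
    (hq : 1 < q) (htb : ∀ r, 0 ≤ r → |t r| ≤ C * (1 + r) ^ (-q))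
    (hab : ∀ r, 0 ≤ r → |r * a r| ≤ D * (1 + r) ^ (-q)) {r : ℝ} (hr : 0 ≤ r) :
    |exp (b * l r) - 1| ≤ b * ((C + D) ^ 2 / 2) / (2 * q - 2) * (1 + r) ^ (2 - 2 * q) := by
  set K := b * ((C + D) ^ 2 / 2) with hK
  have hq' : 0 < 2 * q - 2 := by linarith
  have hl := h.continuous_log
  have hpw : ∀ s : ℝ, 0 ≤ s → HasDerivAt (fun s : ℝ => K / (2 * q - 2) * (1 + s) ^ (2 - 2 * q))
      (- (K * (1 + s) ^ (1 - 2 * q))) s := by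
    intro s hs
    have := ((((hasDerivAt_id s).const_add 1).rpow_const (p := 2 - 2 * q)
      (Or.inl (by simp only [id]; positivity)))).const_mul (K / (2 * q - 2))
    refine this.congr_deriv ?_
    have hK' : K / (2 * q - 2) * (2 * q - 2) = K := div_mul_cancel₀ _ hq'.ne'
    rw [id, one_mul, show 2 - 2 * q - 1 = 1 - 2 * q by ring]
    linear_combination (-(1 + s) ^ (1 - 2 * q)) * hK'
  have hanti : AntitoneOn (fun s => exp (b * l s) + K / (2 * q - 2) * (1 + s) ^ (2 - 2 * q))
      (Set.Ici 0) := by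
    have hcont : ContinuousOn
        (fun s => exp (b * l s) + K / (2 * q - 2) * (1 + s) ^ (2 - 2 * q)) (Set.Ici 0) :=
      ContinuousOn.add (Continuous.continuousOn (by fun_prop))
        fun s hs => (hpw s hs).continuousAt.continuousWithinAt
    have hder : ∀ s : ℝ, 0 < s → HasDerivAt
        (fun s => exp (b * l s) + K / (2 * q - 2) * (1 + s) ^ (2 - 2 * q))
        (s * (b * exp (b * l s) * rate n t l a s) + -(K * (1 + s) ^ (1 - 2 * q))) s := fun s hs =>
      (h.hasDerivAt_factor b hs).add (hpw s hs.le)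
    refine antitoneOn_of_deriv_nonpos (convex_Ici 0) hcont ?_ ?_
    · intro s hs
      rw [interior_Ici] at hs
      exact (hder s hs).differentiableAt.differentiableWithinAt
    · intro s hs
      rw [interior_Ici] at hs
      have h1 := (hder s hs).deriv
      have h2 := (le_abs_self _).trans (abs_factor_deriv_le hn h hb htb hab (le_of_lt hs))
      rw [← hK] at h2
      refine h1.le.trans ?_
      linarith
  have hlim : Tendsto (fun s => exp (b * l s) + K / (2 * q - 2) * (1 + s) ^ (2 - 2 * q)) atTop
      (nhds 1) := by
    have h1 : Tendsto (fun s : ℝ => (1 + s) ^ (-(2 * q - 2))) atTop (nhds 0) :=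
      (tendsto_rpow_neg_atTop hq').comp (tendsto_atTop_add_const_left _ _ tendsto_id)
    have := (h.tendsto_exp_mul_log b).add (h1.const_mul (K / (2 * q - 2)))
    simpa [neg_sub] using this
  have hge : 1 ≤ exp (b * l r) + K / (2 * q - 2) * (1 + r) ^ (2 - 2 * q) := by
    refine le_of_tendsto hlim ?_
    filter_upwards [eventually_ge_atTop r] with s hs
    exact hanti (Set.mem_Ici.2 hr) (Set.mem_Ici.2 (hr.trans hs)) hs
  have hle := h.exp_mul_log_le_one hb hr
  rw [abs_le]
  constructor <;> linarith

end Decay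

end RadialProfile

/-- If `P' = b r ^ (m - 1)` with `b → L` and `m > 0`, then `P / r ^ m → L / m`. -/
theorem tendsto_div_rpow_of_hasDerivAt {P b : ℝ → ℝ} {m L : ℝ} (hm : 0 < m)
    (hP : ∀ r, 0 < r → HasDerivAt P (r ^ (m - 1) * b r) r) (hb : Tendsto b atTop (nhds L)) :
    Tendsto (fun r => P r / r ^ m) atTop (nhds (L / m)) := by
  set Q : ℝ → ℝ := fun r => P r - L / m * r ^ m with hQ
  have hpow : ∀ r : ℝ, 0 < r → HasDerivAt (fun r : ℝ => r ^ m) (m * r ^ (m - 1)) r := fun r hr =>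
    Real.hasDerivAt_rpow_const (Or.inl hr.ne')
  have hQd : ∀ r, 0 < r → HasDerivAt Q (r ^ (m - 1) * (b r - L)) r := fun r hr => by
    refine ((hP r hr).sub ((hpow r hr).const_mul (L / m))).congr_deriv ?_
    field_simp
  suffices h : Tendsto (fun r => Q r / r ^ m) atTop (nhds 0) by
    have := h.add_const (L / m)
    rw [zero_add] at this
    refine this.congr' ?_
    filter_upwards [eventually_gt_atTop 0] with r hr
    have : r ^ m ≠ 0 := (Real.rpow_pos_of_pos hr m).ne'
    simp only [hQ]
    field_simp
    ring
  rw [Metric.tendsto_atTop]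
  intro ε hε
  obtain ⟨R₀, hR₀⟩ := Metric.tendsto_atTop.1 hb (ε * m / 2) (by positivity)
  set R := max R₀ 1
  have hR : 0 < R := lt_of_lt_of_le one_pos (le_max_right _ _)
  have hbR : ∀ r, R ≤ r → |b r - L| ≤ ε * m / 2 := fun r hr => by
    have := hR₀ r ((le_max_left _ _).trans hr)
    rw [Real.dist_eq] at this
    exact this.le
  have hmono : ∀ σ : ℝ, |σ| = 1 → MonotoneOn (fun r => ε / 2 * r ^ m + σ * Q r) (Set.Ici R) := by
    intro σ hσ
    have hder : ∀ r, R ≤ r → HasDerivAt (fun r => ε / 2 * r ^ m + σ * Q r)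
        (ε / 2 * (m * r ^ (m - 1)) + σ * (r ^ (m - 1) * (b r - L))) r := fun r hr =>
      ((hpow r (hR.trans_le hr)).const_mul _).add ((hQd r (hR.trans_le hr)).const_mul _)
    refine monotoneOn_of_deriv_nonneg (convex_Ici R)
      (fun r hr => (hder r hr).continuousAt.continuousWithinAt) (fun r hr => ?_) fun r hr => ?_
    · rw [interior_Ici] at hr
      exact (hder r (le_of_lt hr)).differentiableAt.differentiableWithinAt
    · rw [interior_Ici] at hr
      have hr' : R ≤ r := le_of_lt hr
      rw [(hder r hr').deriv]
      have h1 : |σ * (b r - L)| ≤ ε * m / 2 := by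
        rw [abs_mul, hσ, one_mul]; exact hbR r hr'
      have h2 := (abs_le.1 h1).1
      have h3 : 0 < r ^ (m - 1) := Real.rpow_pos_of_pos (hR.trans_le hr') _
      nlinarith
  have hinf : Tendsto (fun r : ℝ => r ^ m) atTop atTop := tendsto_rpow_atTop hm
  obtain ⟨R₁, hR₁⟩ := (hinf.eventually_gt_atTop (2 * |Q R| / ε)).exists_forall_of_atTop
  refine ⟨max R R₁, fun r hr => ?_⟩
  have hr1 : R ≤ r := (le_max_left _ _).trans hr
  have hpos : 0 < r ^ m := Real.rpow_pos_of_pos (hR.trans_le hr1) m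
  have hposR : 0 < R ^ m := Real.rpow_pos_of_pos hR m
  have h1 := hR₁ r ((le_max_right _ _).trans hr)
  rw [div_lt_iff₀ hε] at h1
  have h2 := hmono 1 (by simp) (Set.mem_Ici.2 le_rfl) (Set.mem_Ici.2 hr1) hr1
  have h3 := hmono (-1) (by simp) (Set.mem_Ici.2 le_rfl) (Set.mem_Ici.2 hr1) hr1
  simp only [one_mul, neg_one_mul] at h2 h3
  rw [dist_zero_right, Real.norm_eq_abs, abs_div, abs_of_pos hpos, div_lt_iff₀ hpos, abs_lt]
  have h4 := le_abs_self (Q R)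
  have h5 := neg_abs_le (Q R)
  have h6 : 0 < ε / 2 * R ^ m := by positivity
  constructor <;> linarith

/-- A continuous function whose absolute value has a positive limit has a nonzero limit. -/
theorem exists_tendsto_of_tendsto_abs {f : ℝ → ℝ} {c : ℝ} (hf : ContinuousOn f (Set.Ioi 0))
    (hc : 0 < c) (h : Tendsto (fun r => |f r|) atTop (nhds c)) :
    ∃ L ≠ 0, Tendsto f atTop (nhds L) := by
  obtain ⟨R₀, hR₀⟩ := (h.eventually (lt_mem_nhds hc)).exists_forall_of_atTop
  set R := max R₀ 1
  have hR : 0 < R := lt_of_lt_of_le one_pos (le_max_right _ _)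
  have hne : ∀ r, R ≤ r → f r ≠ 0 := fun r hr =>
    abs_pos.1 (hR₀ r ((le_max_left _ _).trans hr))
  have hnz : ∀ r, R ≤ r → (0 : ℝ) ∉ Set.uIcc (f R) (f r) := fun r hr h0 => by
    have hsub : Set.uIcc R r ⊆ Set.Ioi 0 := fun s hs => by
      rw [Set.uIcc_of_le hr] at hs
      exact hR.trans_le hs.1
    obtain ⟨s, hs, hs0⟩ := intermediate_value_uIcc (hf.mono hsub) h0
    rw [Set.uIcc_of_le hr] at hs
    exact hne s hs.1 hs0
  rcases lt_or_gt_of_ne (hne R le_rfl) with hneg | hpos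
  · refine ⟨-c, by linarith, h.neg.congr' ?_⟩
    filter_upwards [eventually_ge_atTop R] with r hr
    rw [abs_of_neg, neg_neg]
    by_contra hcon
    exact hnz r hr (Set.mem_uIcc.2 (Or.inl ⟨hneg.le, not_lt.1 hcon⟩))
  · refine ⟨c, hc.ne', h.congr' ?_⟩
    filter_upwards [eventually_ge_atTop R] with r hr
    rw [abs_of_pos]
    by_contra hcon
    exact hnz r hr (Set.mem_uIcc.2 (Or.inr ⟨not_lt.1 hcon, hpos.le⟩))

/-- Exact decay of the mean curvature passes on to the derivative of the conformal factor. -/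
theorem RadialProfile.tendsto_factor_deriv {n : ℕ} {t d l a : ℝ → ℝ} {q C D b c : ℝ} (hn : 1 ≤ n)
    (h : RadialProfile n t d l a) (hb : 0 < b) (hq : 1 < q) (hqn : q < n) (hc : 0 < c)
    (htb : ∀ r, 0 ≤ r → |t r| ≤ C * (1 + r) ^ (-q))
    (hab : ∀ r, 0 ≤ r → |r * a r| ≤ D * (1 + r) ^ (-q))
    (hlim : Tendsto (fun r => r ^ q * |t r|) atTop (nhds c)) :
    ∃ L > 0, Tendsto (fun r => r ^ (2 * q - 1) * (r * (b * exp (b * l r) * rate n t l a r)))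
      atTop (nhds L) := by
  have hnq : 0 < (n : ℝ) - q := sub_pos.2 hqn
  have hn0 : (0 : ℝ) < n := by positivity
  obtain ⟨T, hT0, hT⟩ : ∃ T ≠ 0, Tendsto (fun r => r ^ q * t r) atTop (nhds T) := by
    refine exists_tendsto_of_tendsto_abs ?_ hc (hlim.congr' ?_)
    · exact ContinuousOn.mul
        (fun r hr => (Real.continuousAt_rpow_const r q (Or.inl (ne_of_gt hr))).continuousWithinAt)
        h.continuous_mean.continuousOn
    · filter_upwards [eventually_gt_atTop 0] with r hr
      rw [abs_mul, abs_of_pos (Real.rpow_pos_of_pos hr q)]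
  have hrate : Tendsto (fun r => r ^ 2 * rate n t l a r) atTop (nhds 0) := by
    have h1 : Tendsto (fun r : ℝ => (C + D) ^ 2 / 2 * (1 + r) ^ (-(2 * q - 2))) atTop (nhds 0) := by
      have := ((tendsto_rpow_neg_atTop (show 0 < 2 * q - 2 by linarith)).comp
        (tendsto_atTop_add_const_left atTop (1 : ℝ) tendsto_id)).const_mul ((C + D) ^ 2 / 2)
      simpa using this
    refine squeeze_zero' (Eventually.of_forall fun r => mul_nonneg (sq_nonneg r)
      (rate_nonneg r)) ?_ h1
    filter_upwards [eventually_ge_atTop 0] with r hr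
    have h2 := rate_le hn h htb hab hr
    have h3 : (1 + r) ^ (-(2 * q - 2)) = (1 + r) ^ 2 * (1 + r) ^ (-2 * q) := by
      rw [← Real.rpow_natCast, ← Real.rpow_add (by positivity)]
      push_cast; ring_nf
    have h4 : r ^ 2 ≤ (1 + r) ^ 2 := by nlinarith
    rw [h3]
    calc r ^ 2 * rate n t l a r
        ≤ (1 + r) ^ 2 * ((C + D) ^ 2 / 2 * (1 + r) ^ (-2 * q)) :=
          mul_le_mul h4 h2 (rate_nonneg r) (by positivity)
      _ = _ := by ring
  set κ : ℝ → ℝ := fun r => (t r - r * a r) / n with hκ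
  have hPd : ∀ r, 0 < r → HasDerivAt (fun r => r ^ n * exp (n * l r) * κ r)
      (r ^ ((n : ℝ) - q - 1) *
        (exp (n * l r) * (1 + r ^ 2 * rate n t l a r) * (r ^ q * t r))) r := by
    intro r hr
    have hl' : HasDerivAt l (r * rate n t l a r) r := h.hasDerivAt_log r hr
    have hpow : HasDerivAt (fun r : ℝ => r ^ n) (n * r ^ n / r) r := by
      refine (hasDerivAt_pow n r).congr_deriv ?_
      obtain ⟨m, rfl⟩ := Nat.exists_eq_add_of_le' hn
      rw [Nat.add_sub_cancel, pow_succ]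
      field_simp
    refine ((hpow.mul (hl'.const_mul (n : ℝ)).exp).mul (hasDerivAt_quot hn h hr)).congr_deriv ?_
    have hsplit : r ^ n = r ^ ((n : ℝ) - q - 1) * r ^ q * r := by
      rw [← Real.rpow_add hr, ← Real.rpow_add_one hr.ne', ← Real.rpow_natCast]
      ring_nf
    simp only [Pi.mul_apply]
    rw [hsplit]
    field_simp
    ring
  have hPl := tendsto_div_rpow_of_hasDerivAt hnq hPd
    (((h.tendsto_exp_mul_log n).mul (hrate.const_add 1)).mul hT)
  have hκl : Tendsto (fun r => r ^ q * κ r) atTop (nhds (T / (n - q))) := by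
    have h1 := hPl.mul (h.tendsto_exp_mul_log (-n))
    have e : 1 * (1 + 0) * T / ((n : ℝ) - q) * 1 = T / (n - q) := by ring
    rw [e] at h1
    refine h1.congr' ?_
    filter_upwards [eventually_gt_atTop 0] with r hr
    rw [neg_mul, Real.exp_neg, Real.rpow_sub hr, Real.rpow_natCast]
    have h2 := (exp_pos (n * l r)).ne'
    have h3 := (Real.rpow_pos_of_pos hr q).ne'
    field_simp
  refine ⟨b * 1 * ((1 * (T / (n - q))) ^ 2 / (2 + 0)), ?_, ?_⟩
  · have : T / ((n : ℝ) - q) ≠ 0 := div_ne_zero hT0 hnq.ne'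
    positivity
  · have h1 := ((h.tendsto_exp_mul_log b).const_mul b).mul
      ((((h.tendsto_exp_mul_log 1).mul hκl).pow 2).div (hrate.const_add 2) (by norm_num))
    refine h1.congr' ?_
    filter_upwards [eventually_gt_atTop 0] with r hr
    have h2 := rate_quadratic (n := n) (t := t) (l := l) (a := a) r
    have h3 : slope n t l a r = exp (l r) * κ r := rfl
    have h4 : r ^ (2 * q - 1) = (r ^ q) ^ 2 / r := by
      rw [Real.rpow_sub_one hr.ne', ← Real.rpow_mul_natCast hr.le]
      push_cast; ring_nf
    have h5 : 2 + r ^ 2 * rate n t l a r ≠ 0 := by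
      have := rate_nonneg (n := n) (t := t) (l := l) (a := a) r
      positivity
    rw [h3] at h2
    simp only [Pi.div_apply, one_mul]
    rw [h4]
    field_simp
    linear_combination (-1 : ℝ) * h2

section RadialOperators

variable {n : ℕ} {g g₁ g₂ : ℝ → ℝ}

theorem norm_mul_sum_dirCos_sq (x : EuclideanSpace ℝ (Fin n)) :
    ‖x‖ * ∑ i, dirCos i x ^ 2 = ‖x‖ := by
  rcases eq_or_ne x 0 with rfl | hx
  · simp
  · rw [sum_dirCos_sq hx, mul_one]

theorem dirCos_mul_sum_dirCos_sq (i : Fin n) (x : EuclideanSpace ℝ (Fin n)) :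
    dirCos i x * ∑ k, dirCos k x ^ 2 = dirCos i x := by
  rcases eq_or_ne x 0 with rfl | hx
  · simp [dirCos]
  · rw [sum_dirCos_sq hx, mul_one]

theorem RadialC2.pd_eq (h : RadialC2 g g₁ g₂) (i j : Fin n) :
    pd (fun y : EuclideanSpace ℝ (Fin n) => g ‖y‖ * y i) j = radialJac g g₁ i j :=
  funext fun x => _root_.pd_eq (h.hasFDerivAt i x) j

theorem RadialC2.pd_radialJac (h : RadialC2 g g₁ g₂) (i j k : Fin n) :
    pd (radialJac g g₁ i j) k = radialHess g₁ g₂ i j k :=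
  funext fun x => _root_.pd_eq (h.hasFDerivAt_radialJac i j x) k

theorem sum_radialJac (g g₁ : ℝ → ℝ) (x : EuclideanSpace ℝ (Fin n)) :
    ∑ k, radialJac g g₁ k k x = n * g ‖x‖ + ‖x‖ * g₁ ‖x‖ := by
  simp only [radialJac, if_true, one_mul, Finset.sum_add_distrib, Finset.sum_const,
    Finset.card_univ, Fintype.card_fin, nsmul_eq_mul, ← pow_two, ← Finset.mul_sum]
  linear_combination g₁ ‖x‖ * norm_mul_sum_dirCos_sq x

theorem RadialC2.lap_eq (h : RadialC2 g g₁ g₂) (i : Fin n) (x : EuclideanSpace ℝ (Fin n)) :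
    lap (fun y : EuclideanSpace ℝ (Fin n) => g ‖y‖ * y i) x =
      ((n + 1) * g₁ ‖x‖ + g₂ ‖x‖) * dirCos i x := by
  have e : ∀ k, radialHess g₁ g₂ i k k x = 2 * ((if k = i then 1 else 0) * (g₁ ‖x‖ * dirCos k x))
      + g₁ ‖x‖ * dirCos i x + (g₂ ‖x‖ - g₁ ‖x‖) * dirCos i x * dirCos k x ^ 2 := fun k => by
    simp only [radialHess, if_true]; ring
  simp only [lap, h.pd_eq, h.pd_radialJac, e, Finset.sum_add_distrib, ← Finset.mul_sum, ite_mul,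
    one_mul, zero_mul, Finset.sum_ite_eq', Finset.mem_univ, if_true, Finset.sum_const,
    Finset.card_univ, Fintype.card_fin, nsmul_eq_mul]
  linear_combination (g₂ ‖x‖ - g₁ ‖x‖) * dirCos_mul_sum_dirCos_sq i x

theorem RadialC2.pd_div_eq (h : RadialC2 g g₁ g₂) (i : Fin n) (x : EuclideanSpace ℝ (Fin n)) :
    pd (fun y => ∑ j : Fin n, pd (fun y : EuclideanSpace ℝ (Fin n) => g ‖y‖ * y j) j y) i x =
      ((n + 1) * g₁ ‖x‖ + g₂ ‖x‖) * dirCos i x := by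
  have hs : HasFDerivAt (fun y : EuclideanSpace ℝ (Fin n) => ∑ j, radialJac g g₁ j j y)
      (∑ j, coeffForm fun k => radialHess g₁ g₂ j j k x) x :=
    HasFDerivAt.fun_sum fun j _ => h.hasFDerivAt_radialJac j j x
  have e : ∀ k, radialHess g₁ g₂ k k i x = 2 * ((if i = k then 1 else 0) * (g₁ ‖x‖ * dirCos k x))
      + g₁ ‖x‖ * dirCos i x + (g₂ ‖x‖ - g₁ ‖x‖) * dirCos i x * dirCos k x ^ 2 := fun k => by
    simp only [radialHess, if_true]; ring
  simp only [h.pd_eq]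
  rw [pd, hs.fderiv, sum_apply]
  simp only [coeffForm_single, e, Finset.sum_add_distrib, ← Finset.mul_sum, ite_mul,
    one_mul, zero_mul, Finset.sum_ite_eq, Finset.mem_univ, if_true, Finset.sum_const,
    Finset.card_univ, Fintype.card_fin, nsmul_eq_mul]
  linear_combination (g₂ ‖x‖ - g₁ ‖x‖) * dirCos_mul_sum_dirCos_sq i x

theorem RadialC2.cK_eq (hn : 1 ≤ n) (h : RadialC2 g g₁ g₂) (i j : Fin n)
    (x : EuclideanSpace ℝ (Fin n)) :
    cK (fun i (y : EuclideanSpace ℝ (Fin n)) => g ‖y‖ * y i) i j x =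
      2 * (‖x‖ * g₁ ‖x‖) * (dirCos i x * dirCos j x - (if i = j then 1 else 0) / n) := by
  have hn0 : (n : ℝ) ≠ 0 := by positivity
  simp only [cK, h.pd_eq, sum_radialJac]
  simp only [radialJac, eq_comm (a := j) (b := i)]
  field_simp
  ring

theorem RadialC2.sum_cK_sq (hn : 1 ≤ n) (h : RadialC2 g g₁ g₂) (x : EuclideanSpace ℝ (Fin n)) :
    ∑ i : Fin n, ∑ j : Fin n, cK (fun i (y : EuclideanSpace ℝ (Fin n)) => g ‖y‖ * y i) i j x ^ 2 =
      4 * (‖x‖ * g₁ ‖x‖) ^ 2 * ((n - 1) / n) := by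
  have hn0 : (n : ℝ) ≠ 0 := by positivity
  simp only [h.cK_eq hn]
  rcases eq_or_ne x 0 with rfl | hx
  · simp
  have e : ∀ i j, (2 * (‖x‖ * g₁ ‖x‖) * (dirCos i x * dirCos j x - (if i = j then 1 else 0) / n)) ^ 2
      = 4 * (‖x‖ * g₁ ‖x‖) ^ 2 * (dirCos i x ^ 2 * dirCos j x ^ 2
        + (if i = j then 1 / (n : ℝ) ^ 2 - 2 / n * dirCos j x ^ 2 else 0)) := fun i j => by
    split_ifs with hij
    · subst hij; ring
    · ring
  simp only [e, ← Finset.mul_sum, Finset.sum_add_distrib, Finset.sum_ite_eq, Finset.mem_univ,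
    if_true, Finset.sum_sub_distrib, sum_dirCos_sq hx, mul_one, Finset.sum_const,
    Finset.card_univ, Fintype.card_fin, nsmul_eq_mul]
  field_simp
  ring

theorem RadialC2.abs_cK_le (hn : 1 ≤ n) (h : RadialC2 g g₁ g₂) (i j : Fin n)
    (x : EuclideanSpace ℝ (Fin n)) :
    |cK (fun i (y : EuclideanSpace ℝ (Fin n)) => g ‖y‖ * y i) i j x| ≤
      4 * |‖x‖ * g₁ ‖x‖| := by
  have h1 : |dirCos i x * dirCos j x| ≤ 1 := by
    rw [abs_mul]
    exact mul_le_one₀ (abs_dirCos_le i x) (abs_nonneg _) (abs_dirCos_le j x)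
  have h2 : |(if i = j then (1 : ℝ) else 0) / n| ≤ 1 :=
    abs_div_le_of_one_le hn (by split_ifs <;> simp)
  rw [h.cK_eq hn, abs_mul, abs_mul, abs_two]
  have h3 := (abs_sub _ _).trans (add_le_add h1 h2)
  nlinarith [abs_nonneg (‖x‖ * g₁ ‖x‖)]

end RadialOperators

section RadialRestriction

variable {n : ℕ} {τ : EuclideanSpace ℝ (Fin n) → ℝ} {τ₀ : ℝ → ℝ}
  {e : EuclideanSpace ℝ (Fin n)}

/-- Restriction of a radial `C¹` function to a line through the origin. -/
theorem hasDerivAt_comp_line (hτ : ContDiff ℝ 1 τ) (r : ℝ) :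
    HasDerivAt (fun r : ℝ => τ (r • e)) (fderiv ℝ τ (r • e) e) r := by
  have h1 : HasDerivAt (fun r : ℝ => r • e) e r := by
    simpa using (hasDerivAt_id r).smul_const e
  exact ((hτ.differentiable one_ne_zero).differentiableAt.hasFDerivAt).comp_hasDerivAt r h1

theorem continuous_fderiv_line (hτ : ContDiff ℝ 1 τ) :
    Continuous fun r : ℝ => fderiv ℝ τ (r • e) e := by
  have := hτ.continuous_fderiv one_ne_zero
  fun_prop

theorem fderiv_zero_of_radial (hτ : ContDiff ℝ 1 τ) (hrad : ∀ x, τ x = τ₀ ‖x‖) :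
    fderiv ℝ τ ((0 : ℝ) • e) e = 0 := by
  have h1 := hasDerivAt_comp_line (e := e) hτ 0
  have h2 := hasDerivAt_comp_line (e := -e) hτ 0
  have h3 : (fun r : ℝ => τ (r • -e)) = fun r : ℝ => τ (r • e) := funext fun r => by
    rw [hrad, hrad, smul_neg, norm_neg]
  rw [h3] at h2
  have h4 := h1.unique h2
  simp only [zero_smul, map_neg] at h4 ⊢
  linarith

end RadialRestriction

theorem RadialProfile.hasFDerivAt_factor {n : ℕ} {t d l a : ℝ → ℝ}
    (h : RadialProfile n t d l a) (b : ℝ) (x : EuclideanSpace ℝ (Fin n)) :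
    HasFDerivAt (fun y : EuclideanSpace ℝ (Fin n) => exp (b * l ‖y‖))
      (coeffForm fun k => ‖x‖ * (b * exp (b * l ‖x‖) * rate n t l a ‖x‖) * dirCos k x) x := by
  have hl := h.continuous_log
  have hp := h.continuous_rate
  exact hasFDerivAt_radial_everywhere (a := fun r => exp (b * l r))
    (a₁ := fun r => r * (b * exp (b * l r) * rate n t l a r)) (by fun_prop) (by fun_prop)
    (by simp) (fun r hr => h.hasDerivAt_factor b hr) x

theorem RadialProfile.contDiff_factor {n : ℕ} {t d l a : ℝ → ℝ} (hn : 1 ≤ n)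
    (h : RadialProfile n t d l a) (b : ℝ) :
    ContDiff ℝ 3 fun y : EuclideanSpace ℝ (Fin n) => exp (b * l ‖y‖) := by
  obtain ⟨ψ₂, hψ⟩ := radialC2_gradient hn h b
  have hpart : ∀ k : Fin n, ContDiff ℝ 2 fun x : EuclideanSpace ℝ (Fin n) =>
      ‖x‖ * (b * exp (b * l ‖x‖) * rate n t l a ‖x‖) * dirCos k x := fun k => by
    convert hψ.contDiff (n := n) k using 2 with x
    rw [mul_comm ‖x‖, mul_assoc, norm_mul_dirCos]
  exact mod_cast contDiff_succ_of_partials (m := 2) (h.hasFDerivAt_factor b) hpart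

/-- The conformal data attached to a radial profile solve the conformal constraint equations. -/
theorem RadialProfile.solvesCCE {n : ℕ} {t d l a : ℝ → ℝ} {b : ℝ}
    {τ : EuclideanSpace ℝ (Fin n) → ℝ} (hn : 3 ≤ n) (h : RadialProfile n t d l a)
    (hb : 1 + b = n / 2) (hτ : ∀ x, τ x = t ‖x‖) :
    SolvesCCE n (fun x => exp (b * l ‖x‖)) τ
      (fun i x => (∫ s in (0 : ℝ)..‖x‖, exp (n * l s) / 2 * a s) * x i) := by
  have hn1 : 1 ≤ n := by omega
  have hn3 : (3 : ℝ) ≤ n := by exact_mod_cast hn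
  have hn0 : (n : ℝ) ≠ 0 := by positivity
  have hn2 : (n : ℝ) - 2 ≠ 0 := by linarith
  have hbn : b = (n - 2) / 2 := by linarith
  have hNb : b * Nc n = n := by
    rw [hbn, Nc]; field_simp
  obtain ⟨ψ₂, hψ⟩ := radialC2_gradient hn1 h b
  have hf := h.radialC2_vector
  have hpdφ : ∀ k : Fin n, pd (fun x : EuclideanSpace ℝ (Fin n) => exp (b * l ‖x‖)) k =
      fun x => b * exp (b * l ‖x‖) * rate n t l a ‖x‖ * x k := fun k => funext fun x => by
    rw [_root_.pd_eq (h.hasFDerivAt_factor b x), mul_comm ‖x‖, mul_assoc, norm_mul_dirCos]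
  refine ⟨fun x => ?_, fun i x => ?_⟩
  · have hlap : lap (fun x : EuclideanSpace ℝ (Fin n) => exp (b * l ‖x‖)) x =
        b / (2 * n) * (exp (b * l ‖x‖) * exp (l ‖x‖) ^ 2) * (t ‖x‖ ^ 2 - (‖x‖ * a ‖x‖) ^ 2) := by
      simp only [lap, hpdφ]
      rw [← laplace_identity hn1 b hb ‖x‖]
      exact (Finset.sum_congr rfl fun i _ => congrFun (hψ.pd_eq i i) x).trans (sum_radialJac _ _ x)
    rw [hlap, hf.sum_cK_sq hn1, hτ, ← Real.exp_mul, ← Real.exp_mul]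
    have e1 : exp (b * l ‖x‖ * (Nc n - 1)) = exp (b * l ‖x‖) * exp (l ‖x‖) ^ 2 := by
      rw [← Real.exp_nat_mul, ← Real.exp_add]
      congr 1; push_cast; linear_combination l ‖x‖ * hNb - 2 * l ‖x‖ * hbn
    have e2 : exp (b * l ‖x‖ * (-Nc n - 1)) =
        exp (b * l ‖x‖) * exp (l ‖x‖) ^ 2 / exp (n * l ‖x‖) ^ 2 := by
      rw [eq_div_iff (by positivity), ← Real.exp_nat_mul, ← Real.exp_nat_mul, ← Real.exp_add,
        ← Real.exp_add]
      congr 1; push_cast; linear_combination -l ‖x‖ * hNb - 2 * l ‖x‖ * hbn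
    rw [e1, e2, hbn]
    have := (exp_pos (n * l ‖x‖)).ne'
    field_simp
    ring
  · have hτd : pd τ i x = d ‖x‖ * dirCos i x := by
      rw [show τ = fun x => t ‖x‖ from funext hτ]
      exact _root_.pd_eq (hasFDerivAt_radial_everywhere h.continuous_mean h.continuous_deriv
        h.deriv_zero (fun r _ => h.hasDerivAt_mean r) x) i
    rw [hf.lap_eq, hf.pd_div_eq, hτd, ← Real.exp_mul,
      show b * l ‖x‖ * Nc n = n * l ‖x‖ by linear_combination l ‖x‖ * hNb]
    field_simp
    ring

theorem sqrt_sum_sq_le {n : ℕ} {A : Fin n → Fin n → ℝ} {M : ℝ} (hM : 0 ≤ M)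
    (h : ∀ i j, |A i j| ≤ M) : √(∑ i, ∑ j, A i j ^ 2) ≤ n * M := by
  rw [Real.sqrt_le_left (by positivity)]
  calc ∑ i, ∑ j, A i j ^ 2 ≤ ∑ _i : Fin n, ∑ _j : Fin n, M ^ 2 :=
        Finset.sum_le_sum fun i _ => Finset.sum_le_sum fun j _ =>
          sq_le_sq' (abs_le.1 (h i j)).1 (abs_le.1 (h i j)).2
    _ = (n * M) ^ 2 := by simp; ring

/-- Decay of the second fundamental form. -/
theorem RadialProfile.abs_kTen_le {n : ℕ} {t d l a : ℝ → ℝ} {b q C D : ℝ}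
    {τ : EuclideanSpace ℝ (Fin n) → ℝ} (hn : 3 ≤ n) (h : RadialProfile n t d l a)
    (hb : 1 + b = n / 2) (hτ : ∀ x, τ x = t ‖x‖)
    (htb : ∀ r, 0 ≤ r → |t r| ≤ C * (1 + r) ^ (-q))
    (hab : ∀ r, 0 ≤ r → |r * a r| ≤ D * (1 + r) ^ (-q)) (i j : Fin n)
    (x : EuclideanSpace ℝ (Fin n)) :
    |kTen n (fun x => exp (b * l ‖x‖)) τ
      (fun i x => (∫ s in (0 : ℝ)..‖x‖, exp (n * l s) / 2 * a s) * x i) i j x| ≤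
      (C + 2 * D) * (1 + ‖x‖) ^ (-q) := by
  have hn1 : 1 ≤ n := by omega
  have hn3 : (3 : ℝ) ≤ n := by exact_mod_cast hn
  have hn2 : (n : ℝ) - 2 ≠ 0 := by linarith
  have hbn : b = (n - 2) / 2 := by linarith
  have hNb : b * Nc n = n := by
    rw [hbn, Nc]; field_simp
  have hl1 : exp (2 * l ‖x‖) ≤ 1 := h.exp_mul_log_le_one zero_le_two (norm_nonneg x)
  have hcK := h.radialC2_vector.abs_cK_le hn1 i j x
  set u := cK (fun i (x : EuclideanSpace ℝ (Fin n)) =>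
    (∫ s in (0 : ℝ)..‖x‖, exp (n * l s) / 2 * a s) * x i) i j x
  have e1 : exp (b * l ‖x‖) ^ (Nc n - 2) = exp (2 * l ‖x‖) := by
    rw [← Real.exp_mul]
    congr 1; linear_combination l ‖x‖ * hNb - 2 * l ‖x‖ * hbn
  have e2 : exp (b * l ‖x‖) ^ (-2 : ℝ) * exp (n * l ‖x‖) = exp (2 * l ‖x‖) := by
    rw [← Real.exp_mul, ← Real.exp_add]
    congr 1; linear_combination -2 * l ‖x‖ * hbn
  have h1 : |τ x / n * exp (b * l ‖x‖) ^ (Nc n - 2) * (if i = j then (1 : ℝ) else 0)| ≤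
      C * (1 + ‖x‖) ^ (-q) := by
    have h2 := abs_div_le_of_one_le hn1 (htb _ (norm_nonneg x))
    rw [hτ, e1, abs_mul, abs_mul, abs_of_pos (exp_pos _)]
    refine (mul_le_of_le_one_right (by positivity) (by split_ifs <;> simp)).trans ?_
    exact (mul_le_of_le_one_right (abs_nonneg _) hl1).trans h2
  have h2 : |exp (b * l ‖x‖) ^ (-2 : ℝ) * u| ≤ 2 * D * (1 + ‖x‖) ^ (-q) := by
    rw [abs_mul, abs_of_pos (by positivity)]
    calc exp (b * l ‖x‖) ^ (-2 : ℝ) * |u|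
        ≤ exp (b * l ‖x‖) ^ (-2 : ℝ) * (4 * |‖x‖ * (exp (n * l ‖x‖) / 2 * a ‖x‖)|) := by gcongr
      _ = exp (b * l ‖x‖) ^ (-2 : ℝ) * exp (n * l ‖x‖) * (2 * |‖x‖ * a ‖x‖|) := by
        rw [show ‖x‖ * (exp (n * l ‖x‖) / 2 * a ‖x‖) = exp (n * l ‖x‖) / 2 * (‖x‖ * a ‖x‖) by ring,
          abs_mul, abs_of_pos (by positivity)]
        ring
      _ ≤ 1 * (2 * (D * (1 + ‖x‖) ^ (-q))) := by
        rw [e2]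
        gcongr
        exact hab _ (norm_nonneg x)
      _ = _ := by ring
  rw [kTen]
  refine (abs_add_le _ _).trans ?_
  linarith

/-- Trichotomy for the flux of a function whose derivative decays like `r ^ (1 - 2 q)`. -/
theorem tendsto_flux_trichotomy {n : ℕ} {q L : ℝ} {v : ℝ → ℝ} (hn : 1 ≤ n) (hL : 0 < L)
    (h : Tendsto (fun r : ℝ => r ^ (2 * q - 1) * v r) atTop (nhds L)) :
    (q < (n : ℝ) / 2 → Tendsto (fun r : ℝ => r ^ (n - 1) * v r) atTop atTop) ∧
      (q = (n : ℝ) / 2 →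
        ∃ L > (0 : ℝ), Tendsto (fun r : ℝ => r ^ (n - 1) * v r) atTop (nhds L)) ∧
      ((n : ℝ) / 2 < q → Tendsto (fun r : ℝ => r ^ (n - 1) * v r) atTop (nhds 0)) := by
  have key : (fun r : ℝ => r ^ ((n : ℝ) - 2 * q) * (r ^ (2 * q - 1) * v r)) =ᶠ[atTop]
      fun r : ℝ => r ^ (n - 1) * v r := by
    filter_upwards [eventually_gt_atTop 0] with r hr
    rw [← mul_assoc, ← Real.rpow_add hr, ← Real.rpow_natCast, Nat.cast_sub hn]
    push_cast; ring_nf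
  refine ⟨fun hq => ?_, fun hq => ⟨L, hL, ?_⟩, fun hq => ?_⟩
  · exact ((tendsto_rpow_atTop (by linarith)).atTop_mul_pos hL h).congr' key
  · refine h.congr' (EventuallyEq.trans (Eventually.of_forall fun r => ?_) key)
    simp [hq, mul_div_cancel₀]
  · have h0 : Tendsto (fun r : ℝ => r ^ ((n : ℝ) - 2 * q)) atTop (nhds 0) := by
      have := tendsto_rpow_neg_atTop (show 0 < 2 * q - n by linarith)
      simpa [neg_sub] using this
    simpa using (h0.mul h).congr' key

/-- For radial `τ` decaying exactly like `c r^{−q}` with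
`q ∈ ((n+2)/4, n)`, there is a radial nondecreasing solution of the conformal
equations whose conformal factor satisfies `lim r^{2q−1} φ'(r) = L₀ ∈ (0,∞)`;
consequently `r^{n−1}φ'(r)` tends to `+∞`, a finite positive limit, or `0`
according as `q < n/2`, `q = n/2`, `q > n/2` — i.e. the ADM mass
`−((n−1)/(2(n−2))) lim r^{n−1}φ'(r)` is `−∞`, negative finite or zero. -/
theorem stmt11 (n : ℕ) (hn : 3 ≤ n) (c q C : ℝ) (hc : 0 < c)
    (hq : ((n : ℝ) + 2) / 4 < q) (hq' : q < (n : ℝ)) (hC : 0 < C)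
    (τ : EuclideanSpace ℝ (Fin n) → ℝ) (τ₀ : ℝ → ℝ)
    (hτrad : ∀ x, τ x = τ₀ ‖x‖)
    (hτreg : ContDiff ℝ 1 τ)
    (hτ0 : ∀ x, |τ x| ≤ C * (1 + ‖x‖) ^ (-q))
    (hτ1 : ∀ x, ‖fderiv ℝ τ x‖ ≤ C * (1 + ‖x‖) ^ (-q - 1))
    (hτlim : Tendsto (fun r : ℝ => r ^ q * |τ₀ r|) atTop (nhds c)) :
    ∃ (φ : EuclideanSpace ℝ (Fin n) → ℝ) (φ₀ : ℝ → ℝ)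
      (W : Fin n → EuclideanSpace ℝ (Fin n) → ℝ),
      (∀ x, φ x = φ₀ ‖x‖) ∧ (∀ x, 0 < φ x) ∧
      MonotoneOn φ₀ (Set.Ici (0 : ℝ)) ∧
      ContDiff ℝ 3 φ ∧
      (∀ i, ContDiff ℝ 2 (W i)) ∧
      SolvesCCE n φ τ W ∧
      (∃ C' > 0, ∀ x,
        |φ x - 1| ≤ C' * (1 + ‖x‖) ^ (2 - 2 * q) ∧
        ‖fderiv ℝ φ x‖ ≤ C' * (1 + ‖x‖) ^ (1 - 2 * q) ∧
        Real.sqrt (∑ i, ∑ j, (kTen n φ τ W i j x) ^ 2) ≤ C' * (1 + ‖x‖) ^ (-q)) ∧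
      -- the limit L₀ = lim r^{2q−1} φ'(r) exists, finite and positive
      (∃ L₀ > (0 : ℝ),
        Tendsto (fun r : ℝ => r ^ (2 * q - 1) * deriv φ₀ r) atTop (nhds L₀)) ∧
      -- trichotomy for the ADM mass flux `lim r^{n−1} φ'(r)`
      ((q < (n : ℝ) / 2 →
          Tendsto (fun r : ℝ => r ^ (n - 1) * deriv φ₀ r) atTop atTop) ∧
        (q = (n : ℝ) / 2 →
          ∃ L > (0 : ℝ),
            Tendsto (fun r : ℝ => r ^ (n - 1) * deriv φ₀ r) atTop (nhds L)) ∧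
        ((n : ℝ) / 2 < q →
          Tendsto (fun r : ℝ => r ^ (n - 1) * deriv φ₀ r) atTop (nhds 0))) := by
  have hn1 : 1 ≤ n := by omega
  have hn3 : (3 : ℝ) ≤ n := by exact_mod_cast hn
  have hq1 : 1 < q := by linarith
  obtain ⟨b, hb⟩ : ∃ b : ℝ, 1 + b = n / 2 := ⟨n / 2 - 1, by ring⟩
  have hb0 : 0 < b := by linarith
  set e : EuclideanSpace ℝ (Fin n) := EuclideanSpace.single ⟨0, hn1⟩ 1
  have he : ‖e‖ = 1 := by simp [e]
  have hnorm : ∀ r : ℝ, 0 ≤ r → ‖r • e‖ = r := fun r hr => by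
    rw [norm_smul, he, mul_one, Real.norm_of_nonneg hr]
  set t : ℝ → ℝ := fun r => τ (r • e) with ht
  have htτ : ∀ x, τ x = t ‖x‖ := fun x => by
    simp only [ht, hτrad, hnorm _ (norm_nonneg x)]
  have htb : ∀ r, 0 ≤ r → |t r| ≤ C * (1 + r) ^ (-q) := fun r hr => by
    simpa only [hnorm r hr] using hτ0 (r • e)
  have hdb : ∀ r, 0 ≤ r → |fderiv ℝ τ (r • e) e| ≤ C * (1 + r) ^ (-q - 1) := fun r hr => by
    have h1 := (fderiv ℝ τ (r • e)).le_opNorm e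
    rw [he, mul_one, Real.norm_eq_abs] at h1
    simpa only [hnorm r hr] using h1.trans (hτ1 (r • e))
  have htlim : Tendsto (fun r : ℝ => r ^ q * |t r|) atTop (nhds c) := by
    refine hτlim.congr' ?_
    filter_upwards [eventually_ge_atTop 0] with r hr
    simp only [ht, hτrad, hnorm r hr]
  obtain ⟨l, a, h, D, hD, hab⟩ := exists_radialProfile hn1 hq1 hq' hC.le
    (continuous_fderiv_line hτreg) (hasDerivAt_comp_line hτreg)
    (fderiv_zero_of_radial hτreg hτrad) htb hdb
  obtain ⟨L, hL, hlim⟩ := h.tendsto_factor_deriv hn1 hb0 hq1 hq' hc htb hab htlim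
  have hlim' : Tendsto (fun r : ℝ => r ^ (2 * q - 1) * deriv (fun r => exp (b * l r)) r) atTop
      (nhds L) := by
    refine hlim.congr' ?_
    filter_upwards [eventually_gt_atTop 0] with r hr
    rw [(h.hasDerivAt_factor b hr).deriv]
  refine ⟨_, fun r => exp (b * l r), _, fun x => rfl, fun x => exp_pos _,
    h.monotoneOn_factor hb0.le, h.contDiff_factor hn1 b, h.radialC2_vector.contDiff,
    h.solvesCCE hn hb htτ, ?_, ⟨L, hL, hlim'⟩, tendsto_flux_trichotomy hn1 hL hlim'⟩
  have hK : 0 ≤ b * ((C + D) ^ 2 / 2) := by positivity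
  have hq2 : 0 < 2 * q - 2 := by linarith
  set K := b * ((C + D) ^ 2 / 2) with hKdef
  have hK₁ : 0 ≤ K / (2 * q - 2) := by positivity
  have hK₂ : 0 ≤ n * (C + 2 * D) := by positivity
  refine ⟨K / (2 * q - 2) + K + n * (C + 2 * D) + 1, by positivity, fun x => ⟨?_, ?_, ?_⟩⟩
  · refine (RadialProfile.abs_factor_sub_one_le hn1 h hb0.le hq1 htb hab (norm_nonneg x)).trans ?_
    rw [← hKdef]
    gcongr
    linarith
  · rw [(h.hasFDerivAt_factor b x).fderiv]
    refine (norm_coeffForm_dirCos_le _ x).trans ?_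
    refine (RadialProfile.abs_factor_deriv_le hn1 h hb0.le htb hab (norm_nonneg x)).trans ?_
    rw [← hKdef]
    gcongr
    linarith
  · refine (sqrt_sum_sq_le (by positivity) fun i j =>
      h.abs_kTen_le hn hb htτ htb hab i j x).trans ?_
    rw [← mul_assoc]
    gcongr
    linarith
end
end

section
/- Let n ≥ 3 be an integer, N = 2n/(n−2), c > 0 and q ∈ ((n+2)/4, n). Let φ be a C² function on [1,∞) with φ > 0 and φ' > 0, satisfying |φ(r) − 1| ≤ C r^{2−2q}, |φ'(r)| ≤ C r^{1−2q}, |φ''(r)| ≤ C r^{−2q}, and suppose lim_{r→∞} r^q F[φ](r) = c. Then lim_{r→∞} r^{2q−1} φ'(r) = c² (n−2) / (4 (n−q)²); in particular this limit exists, is finite and positive. -/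
open scoped BigOperators
open Real Filter MeasureTheory

noncomputable section

/-- One-variable quantity
`F[φ](r) = 2 |(r^{2n−1} (φ^{(N+2)/2})')'| / ((N+2) r^{3n/2} φ^{N−1} √(φ'·(r^{n−2}φ)'))`. -/
def Ff (n : ℕ) (φ : ℝ → ℝ) (r : ℝ) : ℝ :=
  2 * |deriv (fun s : ℝ => s ^ (2 * n - 1) * deriv (fun t : ℝ => φ t ^ ((Nc n + 2) / 2)) s) r| /
    ((Nc n + 2) * r ^ ((3 * (n : ℝ)) / 2) * φ r ^ (Nc n - 1) *
      Real.sqrt (deriv φ r * deriv (fun s : ℝ => s ^ (n - 2) * φ s) r))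

/-- A function whose derivative is asymptotically at most `L * r ^ (a - 1)`, with `a > 0`, is
eventually below `B * r ^ a` for every `B > L / a`. -/
lemma eventually_rpow_neg_mul_lt {a L B : ℝ} (ha : 0 < a) (hB : L / a < B) {f f' : ℝ → ℝ}
    (hf : ∀ᶠ r in atTop, HasDerivAt f (f' r) r)
    (hlim : Tendsto (fun r : ℝ => r ^ (1 - a) * f' r) atTop (nhds L)) :
    ∀ᶠ r : ℝ in atTop, r ^ (-a) * f r < B := by
  obtain ⟨D, hLD, hDB⟩ := exists_between hB
  have hev : ∀ᶠ r : ℝ in atTop, r ^ (1 - a) * f' r < D * a :=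
    hlim.eventually_lt_const ((div_lt_iff₀ ha).1 hLD)
  obtain ⟨R, hR⟩ := eventually_atTop.1 ((hf.and hev).and (eventually_gt_atTop (0 : ℝ)))
  have hder : ∀ r, R ≤ r →
      HasDerivAt (fun s => f s - D * s ^ a) (f' r - D * (a * r ^ (a - 1))) r := fun r hr =>
    (hR r hr).1.1.sub ((Real.hasDerivAt_rpow_const (Or.inl (hR r hr).2.ne')).const_mul D)
  have hanti : AntitoneOn (fun s => f s - D * s ^ a) (Set.Ici R) := by
    refine antitoneOn_of_deriv_nonpos (convex_Ici R)
      (fun r hr => (hder r hr).continuousAt.continuousWithinAt)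
      (fun r hr => (hder r (interior_subset hr)).differentiableAt.differentiableWithinAt) ?_
    intro r hr
    have hr' : R ≤ r := interior_subset hr
    obtain ⟨⟨-, hlt⟩, hpos⟩ := hR r hr'
    rw [(hder r hr').deriv]
    have hinv : r ^ (a - 1) * r ^ (1 - a) = 1 := by
      rw [← Real.rpow_add hpos]; simp
    have hmul := mul_lt_mul_of_pos_left hlt (Real.rpow_pos_of_pos hpos (a - 1))
    rw [← mul_assoc, hinv, one_mul] at hmul
    linarith
  have hzero : Tendsto (fun r : ℝ => r ^ (-a) * (f R - D * R ^ a)) atTop (nhds 0) := by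
    simpa using (tendsto_rpow_neg_atTop ha).mul_const (f R - D * R ^ a)
  filter_upwards [hzero.eventually_lt_const (sub_pos.2 hDB), eventually_ge_atTop R]
    with r hlt hr
  have hpos := (hR r hr).2
  have hle : f r - D * r ^ a ≤ f R - D * R ^ a := hanti Set.self_mem_Ici hr hr
  have hinv : r ^ (-a) * r ^ a = 1 := by
    rw [← Real.rpow_add hpos]; simp
  have hmul := mul_le_mul_of_nonneg_left hle (Real.rpow_pos_of_pos hpos (-a)).le
  linear_combination hmul + hlt + D * hinv

/-- L'Hôpital's rule for the comparison with `r ^ a` at infinity. -/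
lemma tendsto_rpow_neg_mul_of_deriv {a L : ℝ} (ha : 0 < a) {f f' : ℝ → ℝ}
    (hf : ∀ᶠ r in atTop, HasDerivAt f (f' r) r)
    (hlim : Tendsto (fun r : ℝ => r ^ (1 - a) * f' r) atTop (nhds L)) :
    Tendsto (fun r : ℝ => r ^ (-a) * f r) atTop (nhds (L / a)) := by
  refine tendsto_order.2 ⟨fun B hB => ?_, fun B hB => eventually_rpow_neg_mul_lt ha hB hf hlim⟩
  have hneg : -L / a < -B := by rw [neg_div]; linarith
  have hlim' : Tendsto (fun r : ℝ => r ^ (1 - a) * -f' r) atTop (nhds (-L)) := by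
    simpa only [mul_neg] using hlim.neg
  filter_upwards [eventually_rpow_neg_mul_lt ha hneg (hf.mono fun r hr => hr.neg) hlim']
    with r hr
  have : r ^ (-a) * -f r < -B := hr
  linarith

/-- For a nonnegative function, the asymptotics of the absolute value of the derivative determine
those of the function. -/
lemma tendsto_rpow_neg_mul_of_abs_deriv {a K : ℝ} (ha : 0 < a) (hK : 0 < K) {f f' : ℝ → ℝ}
    (hnonneg : ∀ᶠ r in atTop, 0 ≤ f r) (hf : ∀ᶠ r in atTop, HasDerivAt f (f' r) r)
    (hlim : Tendsto (fun r : ℝ => r ^ (1 - a) * |f' r|) atTop (nhds K)) :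
    Tendsto (fun r : ℝ => r ^ (-a) * f r) atTop (nhds (K / a)) := by
  obtain ⟨R, hR⟩ := eventually_atTop.1 (hf.and (hlim.eventually_const_lt hK))
  have hne : ∀ r ∈ Set.Ici R, f' r ≠ 0 := by
    intro r hr h
    simpa [h] using (hR r hr).2
  rcases hasDerivWithinAt_forall_lt_or_forall_gt_of_forall_ne (convex_Ici R)
    (fun r hr => (hR r hr).1.hasDerivWithinAt) hne with hlt | hgt
  · have hlim' : Tendsto (fun r : ℝ => r ^ (1 - a) * f' r) atTop (nhds (-K)) := by
      refine hlim.neg.congr' ?_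
      filter_upwards [eventually_ge_atTop R] with r hr
      rw [abs_of_neg (hlt r hr)]
      ring
    have hneg : -K / a < 0 := div_neg_of_neg_of_pos (neg_neg_of_pos hK) ha
    have hev := (tendsto_rpow_neg_mul_of_deriv ha hf hlim').eventually_lt_const hneg
    obtain ⟨r, ⟨hr, hr0⟩, hrpos⟩ :=
      ((hev.and hnonneg).and (eventually_ge_atTop (0 : ℝ))).exists
    exact absurd (mul_nonneg (Real.rpow_nonneg hrpos _) hr0) (not_le.2 hr)
  · refine tendsto_rpow_neg_mul_of_deriv ha hf (hlim.congr' ?_)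
    filter_upwards [eventually_ge_atTop R] with r hr
    rw [abs_of_pos (hgt r hr)]

/-- The quantity whose derivative is the numerator of `F[φ]`, up to a constant factor. -/
def fluxW (n : ℕ) (φ : ℝ → ℝ) (s : ℝ) : ℝ :=
  s ^ (2 * n - 1) * (φ s ^ (Nc n / 2) * deriv φ s)

lemma Nc_add_two_pos {n : ℕ} (hn : 3 ≤ n) : 0 < Nc n + 2 := by
  have h : (3 : ℝ) ≤ n := by exact_mod_cast hn
  have : 0 ≤ Nc n := div_nonneg (by linarith) (by linarith)
  linarith

lemma deriv_flux_eq {n : ℕ} {φ : ℝ → ℝ} (hφ : ContDiff ℝ 2 φ)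
    (hφpos : ∀ r : ℝ, 1 ≤ r → 0 < φ r) {r : ℝ} (hr : 1 < r) :
    deriv (fun s : ℝ => s ^ (2 * n - 1) * deriv (fun t : ℝ => φ t ^ ((Nc n + 2) / 2)) s) r =
      (Nc n + 2) / 2 * deriv (fluxW n φ) r := by
  have heq : (fun s : ℝ => s ^ (2 * n - 1) * deriv (fun t : ℝ => φ t ^ ((Nc n + 2) / 2)) s)
      =ᶠ[nhds r] fun s => (Nc n + 2) / 2 * fluxW n φ s := by
    filter_upwards [lt_mem_nhds hr] with s hs
    have hd : HasDerivAt φ (deriv φ s) s :=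
      (hφ.differentiable (by norm_num) s).hasDerivAt
    rw [(hd.rpow_const (Or.inl (hφpos s hs.le).ne')).deriv, fluxW,
      show (Nc n + 2) / 2 - 1 = Nc n / 2 by ring]
    ring
  rw [heq.deriv_eq, deriv_const_mul_field]

lemma differentiableAt_fluxW {n : ℕ} {φ : ℝ → ℝ} (hφ : ContDiff ℝ 2 φ) {r : ℝ} (hr : 0 < φ r) :
    DifferentiableAt ℝ (fluxW n φ) r := by
  have hd : DifferentiableAt ℝ φ r := hφ.differentiable (by norm_num) r
  have hd' : DifferentiableAt ℝ (deriv φ) r :=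
    (ContDiff.differentiable_deriv_two hφ) r
  exact (differentiableAt_id.pow _).mul ((hd.rpow_const (Or.inl hr.ne')).mul hd')

lemma fluxW_pos {n : ℕ} {φ : ℝ → ℝ} {r : ℝ} (hr : 0 < r) (hφ : 0 < φ r) (hφ' : 0 < deriv φ r) :
    0 < fluxW n φ r :=
  mul_pos (pow_pos hr _) (mul_pos (Real.rpow_pos_of_pos hφ _) hφ')

lemma deriv_pow_sub_two_mul {n : ℕ} (hn : 3 ≤ n) {φ : ℝ → ℝ} {r : ℝ}
    (hφ : DifferentiableAt ℝ φ r) :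
    deriv (fun s : ℝ => s ^ (n - 2) * φ s) r =
      r ^ (n - 3) * (((n : ℝ) - 2) * φ r + r * deriv φ r) := by
  obtain ⟨k, rfl⟩ := Nat.exists_eq_add_of_le' hn
  have h := ((hasDerivAt_pow (k + 1) r).mul hφ.hasDerivAt).deriv
  simp only [show k + 3 - 2 = k + 1 by omega, show k + 3 - 3 = k by omega]
  refine Eq.trans h ?_
  push_cast
  ring

/-- The derivative of `√(fluxW n φ)` expressed through `F[φ]`. -/
lemma rpow_mul_abs_deriv_sqrt_fluxW {n : ℕ} (hn : 3 ≤ n) (q : ℝ) {φ : ℝ → ℝ}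
    (hφ : ContDiff ℝ 2 φ) (hφpos : ∀ r : ℝ, 1 ≤ r → 0 < φ r) {r : ℝ} (hr : 1 < r)
    (hφ' : 0 < deriv φ r) :
    r ^ (1 - ((n : ℝ) - q)) * |deriv (fluxW n φ) r / (2 * √(fluxW n φ r))| =
      r ^ q * Ff n φ r * (φ r ^ (Nc n - 1) / 2 *
        √((((n : ℝ) - 2) * φ r + r * deriv φ r) / φ r ^ (Nc n / 2))) := by
  have hr0 : 0 < r := one_pos.trans hr
  have hp := hφpos r hr.le
  have hn' : (3 : ℝ) ≤ n := by exact_mod_cast hn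
  have hN := Nc_add_two_pos hn
  rw [Ff, deriv_flux_eq hφ hφpos hr,
    deriv_pow_sub_two_mul hn (hφ.differentiable (by norm_num) r)]
  have hH : 0 < ((n : ℝ) - 2) * φ r + r * deriv φ r :=
    add_pos (mul_pos (by linarith) hp) (mul_pos hr0 hφ')
  have hW := fluxW_pos (n := n) hr0 hp hφ'
  set H := ((n : ℝ) - 2) * φ r + r * deriv φ r
  have hE : 0 < φ r ^ (Nc n / 2) := Real.rpow_pos_of_pos hp _
  have hM : 0 < φ r ^ (Nc n - 1) := Real.rpow_pos_of_pos hp _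
  have hS : 0 < √(deriv φ r * (r ^ (n - 3) * H)) :=
    Real.sqrt_pos.2 (mul_pos hφ' (mul_pos (pow_pos hr0 _) hH))
  have hsq : √(H / φ r ^ (Nc n / 2)) * √(fluxW n φ r) =
      r ^ (((n : ℝ) + 2) / 2) * √(deriv φ r * (r ^ (n - 3) * H)) := by
    have hroot : r ^ (((n : ℝ) + 2) / 2) = √(r ^ (n + 2)) := by
      rw [Real.sqrt_eq_rpow, ← Real.rpow_natCast, ← Real.rpow_mul hr0.le]
      push_cast
      ring_nf
    rw [hroot, ← Real.sqrt_mul (by positivity), ← Real.sqrt_mul (by positivity), fluxW]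
    congr 1
    rw [show 2 * n - 1 = (n + 2) + (n - 3) by omega, pow_add r (n + 2) (n - 3)]
    field_simp
  have hpow : r ^ q * r ^ (((n : ℝ) + 2) / 2) =
      r ^ (1 - ((n : ℝ) - q)) * r ^ ((3 * (n : ℝ)) / 2) := by
    rw [← Real.rpow_add hr0, ← Real.rpow_add hr0]
    ring_nf
  have hT := Real.rpow_pos_of_pos hr0 ((3 * (n : ℝ)) / 2)
  have hV := Real.sqrt_pos.2 hW
  rw [abs_div, abs_of_pos (by linarith : 0 < 2 * √(fluxW n φ r)), abs_mul,
    abs_of_pos (by linarith : 0 < (Nc n + 2) / 2), eq_div_of_mul_eq hV.ne' hsq]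
  generalize r ^ ((3 * (n : ℝ)) / 2) = T at hpow hT ⊢
  field_simp
  linear_combination -|deriv (fluxW n φ) r| * hpow

/-- Asymptotics of the conformal factor: if
`r^q F[φ](r) → c` and `φ` has the stated decay towards `1`, then
`r^{2q−1} φ'(r) → c²(n−2)/(4(n−q)²)`, a finite positive limit. -/
theorem stmt12 (n : ℕ) (hn : 3 ≤ n) (c q C : ℝ) (hc : 0 < c)
    (hq : ((n : ℝ) + 2) / 4 < q) (hq' : q < (n : ℝ)) (hC : 0 < C)
    (φ : ℝ → ℝ)
    (hφreg : ContDiff ℝ 2 φ)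
    (hφpos : ∀ r : ℝ, 1 ≤ r → 0 < φ r)
    (hφ' : ∀ r : ℝ, 1 ≤ r → 0 < deriv φ r)
    (h0 : ∀ r : ℝ, 1 ≤ r → |φ r - 1| ≤ C * r ^ (2 - 2 * q))
    (h1 : ∀ r : ℝ, 1 ≤ r → |deriv φ r| ≤ C * r ^ (1 - 2 * q))
    (h2 : ∀ r : ℝ, 1 ≤ r → |deriv (deriv φ) r| ≤ C * r ^ (-(2 * q)))
    (hF : Filter.Tendsto (fun r : ℝ => r ^ q * Ff n φ r) Filter.atTop (nhds c)) :
    Filter.Tendsto (fun r : ℝ => r ^ (2 * q - 1) * deriv φ r) Filter.atTop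
      (nhds (c ^ 2 * ((n : ℝ) - 2) / (4 * ((n : ℝ) - q) ^ 2))) := by
  have hn' : (3 : ℝ) ≤ n := by exact_mod_cast hn
  have ha : 0 < (n : ℝ) - q := by linarith
  have hdecay : Tendsto (fun r : ℝ => C * r ^ (2 - 2 * q)) atTop (nhds 0) := by
    have h := (tendsto_rpow_neg_atTop (by linarith : 0 < 2 * q - 2)).const_mul C
    simpa only [mul_zero, neg_sub] using h
  have hφone : Tendsto φ atTop (nhds 1) := by
    rw [tendsto_iff_norm_sub_tendsto_zero]
    refine squeeze_zero' (Eventually.of_forall fun r => norm_nonneg _) ?_ hdecay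
    filter_upwards [eventually_ge_atTop 1] with r hr using h0 r hr
  have hrφ' : Tendsto (fun r => r * deriv φ r) atTop (nhds 0) := by
    refine squeeze_zero' ?_ ?_ hdecay
    · filter_upwards [eventually_ge_atTop 1] with r hr
      exact mul_nonneg (by linarith) (hφ' r hr).le
    · filter_upwards [eventually_ge_atTop 1] with r hr
      have hr0 : 0 < r := by linarith
      calc r * deriv φ r ≤ r * (C * r ^ (1 - 2 * q)) :=
            mul_le_mul_of_nonneg_left ((le_abs_self _).trans (h1 r hr)) hr0.le
        _ = C * r ^ (2 - 2 * q) := by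
            rw [show 2 - 2 * q = 1 + (1 - 2 * q) by ring, Real.rpow_add hr0, Real.rpow_one]
            ring
  have hpow : ∀ e : ℝ, Tendsto (fun r => φ r ^ e) atTop (nhds 1) := fun e => by
    simpa using hφone.rpow_const (p := e) (Or.inl one_ne_zero)
  have hfactor : Tendsto (fun r => φ r ^ (Nc n - 1) / 2 *
      √((((n : ℝ) - 2) * φ r + r * deriv φ r) / φ r ^ (Nc n / 2))) atTop
      (nhds (1 / 2 * √((n : ℝ) - 2))) := by
    have h := ((hpow (Nc n - 1)).div_const 2).mul
      ((((hφone.const_mul ((n : ℝ) - 2)).add hrφ').div (hpow (Nc n / 2)) one_ne_zero).sqrt)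
    simpa using h
  have hsqrt : Tendsto (fun r : ℝ => r ^ (-((n : ℝ) - q)) * √(fluxW n φ r)) atTop
      (nhds (c * (1 / 2 * √((n : ℝ) - 2)) / ((n : ℝ) - q))) := by
    have hpos : 0 < √((n : ℝ) - 2) := Real.sqrt_pos.2 (by linarith)
    refine tendsto_rpow_neg_mul_of_abs_deriv ha (by positivity)
      (f' := fun r => deriv (fluxW n φ) r / (2 * √(fluxW n φ r)))
      (Eventually.of_forall fun r => Real.sqrt_nonneg _) ?_ ((hF.mul hfactor).congr' ?_)
    · filter_upwards [eventually_gt_atTop 1] with r hr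
      exact (differentiableAt_fluxW hφreg (hφpos r hr.le)).hasDerivAt.sqrt
        (fluxW_pos (by linarith) (hφpos r hr.le) (hφ' r hr.le)).ne'
    · filter_upwards [eventually_gt_atTop 1] with r hr
      exact (rpow_mul_abs_deriv_sqrt_fluxW hn q hφreg hφpos hr (hφ' r hr.le)).symm
  have hlim := (hsqrt.pow 2).div (hpow (Nc n / 2)) one_ne_zero
  have hval : (c * (1 / 2 * √((n : ℝ) - 2)) / ((n : ℝ) - q)) ^ 2 / 1 =
      c ^ 2 * ((n : ℝ) - 2) / (4 * ((n : ℝ) - q) ^ 2) := by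
    rw [div_one, div_pow, mul_pow, mul_pow, Real.sq_sqrt (by linarith)]
    field_simp
    ring
  rw [hval] at hlim
  refine hlim.congr' ?_
  filter_upwards [eventually_ge_atTop 1] with r hr
  have hr0 : 0 < r := by linarith
  have hE : 0 < φ r ^ (Nc n / 2) := Real.rpow_pos_of_pos (hφpos r hr) _
  have hexp : (r ^ (-((n : ℝ) - q))) ^ 2 * r ^ (2 * n - 1) = r ^ (2 * q - 1) := by
    rw [← Real.rpow_natCast, ← Real.rpow_natCast, ← Real.rpow_mul hr0.le, ← Real.rpow_add hr0,
      Nat.cast_sub (by omega)]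
    push_cast
    ring_nf
  simp only [Pi.div_apply, mul_pow]
  rw [Real.sq_sqrt (fluxW_pos hr0 (hφpos r hr) (hφ' r hr)).le, ← hexp, fluxW]
  field_simp
end
end

section
/- Let n ≥ 3 be an integer, N = 2n/(n−2), and m > 0. Let φ(r) = 1 − m/(2 r^{n−2}) for r ≥ m^{1/(n−2)}. Then φ > 0 and φ' > 0 on (m^{1/(n−2)}, ∞), so F[φ](r) is well defined there, and lim_{r→∞} r^{n/2} F[φ](r) = n √(m/2). In particular, the mean curvature function τ defined by |τ(r)| = F[φ](r) for the smoothed negative mass Schwarzschild data satisfies |τ(r)| ∼ c r^{−n/2} as r → ∞ for the positive constant c = n √(m/2). -/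
open scoped BigOperators
open Real Filter MeasureTheory

noncomputable section

/-- The negative mass Schwarzschild conformal factor, with `k = n − 2`. -/
def negSchwarzschild (k : ℕ) (m s : ℝ) : ℝ := 1 - m / (2 * s ^ k)

lemma hasDerivAt_negSchwarzschild (k : ℕ) (m : ℝ) {r : ℝ} (hr : r ≠ 0) :
    HasDerivAt (negSchwarzschild k m) (m * k / (2 * r ^ (k + 1))) r := by
  have h := (((hasDerivAt_pow k r).const_mul 2).inv (by positivity)).const_mul m
  refine (h.const_sub 1).congr_deriv ?_
  rcases k with _ | k
  · simp
  · push_cast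
    field_simp
    ring

lemma negSchwarzschild_pos {k : ℕ} {m r : ℝ} (hr : 0 < r) (h : m < 2 * r ^ k) :
    0 < negSchwarzschild k m r := by
  rw [negSchwarzschild, sub_pos, div_lt_one (by positivity)]
  exact h

lemma tendsto_negSchwarzschild {k : ℕ} (hk : k ≠ 0) (m : ℝ) :
    Tendsto (negSchwarzschild k m) atTop (nhds 1) := by
  have h : Tendsto (fun s : ℝ => m / (2 * s ^ k)) atTop (nhds 0) :=
    tendsto_const_nhds.div_atTop ((tendsto_pow_atTop hk).const_mul_atTop two_pos)
  have h' := h.const_sub 1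
  rwa [sub_zero] at h'

lemma eventually_lt_two_mul_pow (k : ℕ) (m : ℝ) {r : ℝ} (h : m < 2 * r ^ k) :
    ∀ᶠ s in nhds r, m < 2 * s ^ k :=
  ContinuousAt.eventually_lt (by fun_prop) (by fun_prop) h

lemma deriv_negSchwarzschild_rpow (k : ℕ) (m p : ℝ) {r : ℝ} (hr : 0 < r) (h : m < 2 * r ^ k) :
    deriv (fun t => negSchwarzschild k m t ^ p) r =
      m * k / (2 * r ^ (k + 1)) * p * negSchwarzschild k m r ^ (p - 1) :=
  ((hasDerivAt_negSchwarzschild k m hr.ne').rpow_const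
    (Or.inl (negSchwarzschild_pos hr h).ne')).deriv

lemma deriv_pow_mul_deriv_negSchwarzschild_rpow (k : ℕ) (m p : ℝ) {r : ℝ} (hr : 0 < r)
    (h : m < 2 * r ^ k) :
    deriv (fun s => s ^ (2 * (k + 2) - 1) * deriv (fun t => negSchwarzschild k m t ^ p) s) r =
      p * (m * k / 2) * r * ((k + 2) * r ^ k * negSchwarzschild k m r ^ (p - 1) +
        (p - 1) * (m * k / 2) * negSchwarzschild k m r ^ (p - 2)) := by
  have heq : (fun s => s ^ (2 * (k + 2) - 1) * deriv (fun t => negSchwarzschild k m t ^ p) s)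
      =ᶠ[nhds r] fun s => p * (m * k / 2) * (s ^ (k + 2) * negSchwarzschild k m s ^ (p - 1)) := by
    filter_upwards [lt_mem_nhds hr, eventually_lt_two_mul_pow k m h] with s hs hs'
    rw [deriv_negSchwarzschild_rpow k m p hs hs',
      show 2 * (k + 2) - 1 = (k + 2) + (k + 1) by omega, pow_add]
    field_simp
  rw [heq.deriv_eq]
  have hd := ((hasDerivAt_pow (k + 2) r).mul
    ((hasDerivAt_negSchwarzschild k m hr.ne').rpow_const (p := p - 1)
      (Or.inl (negSchwarzschild_pos hr h).ne'))).const_mul (p * (m * k / 2))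
  refine hd.deriv.trans ?_
  rw [show k + 2 - 1 = k + 1 by omega, show p - 1 - 1 = p - 2 by ring]
  push_cast
  field_simp
  ring

lemma deriv_pow_mul_negSchwarzschild (k : ℕ) (m : ℝ) {r : ℝ} (hr : 0 < r) :
    deriv (fun s => s ^ k * negSchwarzschild k m s) r = k * r ^ (k - 1) := by
  have heq : (fun s => s ^ k * negSchwarzschild k m s) =ᶠ[nhds r] fun s => s ^ k - m / 2 := by
    filter_upwards [lt_mem_nhds hr] with s hs
    rw [negSchwarzschild]
    field_simp
  rw [heq.deriv_eq]
  exact ((hasDerivAt_pow k r).sub_const _).deriv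

lemma sqrt_deriv_mul_deriv_negSchwarzschild {k : ℕ} (hk : k ≠ 0) {m r : ℝ} (hr : 0 < r) :
    √(deriv (negSchwarzschild k m) r * deriv (fun s => s ^ k * negSchwarzschild k m s) r) =
      k / r * √(m / 2) := by
  rw [(hasDerivAt_negSchwarzschild k m hr.ne').deriv, deriv_pow_mul_negSchwarzschild k m hr]
  have : m * k / (2 * r ^ (k + 1)) * (k * r ^ (k - 1)) = (k / r) ^ 2 * (m / 2) := by
    obtain ⟨j, rfl⟩ := Nat.exists_eq_succ_of_ne_zero hk
    simp only [Nat.succ_eq_add_one, Nat.add_sub_cancel]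
    field_simp
    ring
  rw [this, sqrt_mul (sq_nonneg _), sqrt_sq (by positivity)]

lemma Nc_add_two {k : ℕ} (hk : k ≠ 0) : (Nc (k + 2) + 2) / 2 = 2 + 2 / (k : ℝ) := by
  rw [Nc]
  push_cast
  rw [add_sub_cancel_right]
  field_simp
  ring

lemma rpow_mul_Ff_negSchwarzschild {k : ℕ} (hk : k ≠ 0) {m r : ℝ} (hm : 0 < m) (hr : 0 < r)
    (h : m < 2 * r ^ k) :
    r ^ (((k + 2 : ℕ) : ℝ) / 2) * Ff (k + 2) (negSchwarzschild k m) r =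
      √(m / 2) * (((k + 2 : ℕ) : ℝ) * negSchwarzschild k m r ^ (1 + 2 / (k : ℝ)) +
        (1 + 2 / (k : ℝ)) * k * (m / (2 * r ^ k)) * negSchwarzschild k m r ^ (2 / (k : ℝ))) /
        negSchwarzschild k m r ^ (Nc (k + 2) - 1) := by
  have hφ := negSchwarzschild_pos hr h
  have hN := Nc_add_two hk
  have hk' : (0 : ℝ) < k := by positivity
  have hexp : r ^ (3 * ((k + 2 : ℕ) : ℝ) / 2) = r ^ (((k + 2 : ℕ) : ℝ) / 2) * r ^ (k + 2) := by
    rw [← rpow_natCast r (k + 2), ← rpow_add hr]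
    congr 1
    ring
  have hsq : √(m / 2) * √(m / 2) = m / 2 := mul_self_sqrt (by positivity)
  have hm2 : m = 2 * √(m / 2) ^ 2 := by rw [sq, hsq]; ring
  rw [Ff, show k + 2 - 2 = k by omega, sqrt_deriv_mul_deriv_negSchwarzschild hk hr,
    deriv_pow_mul_deriv_negSchwarzschild_rpow k m _ hr h, hN,
    show Nc (k + 2) + 2 = 2 * (2 + 2 / (k : ℝ)) by linarith, hexp,
    show 2 + 2 / (k : ℝ) - 1 = 1 + 2 / (k : ℝ) by ring,
    show 2 + 2 / (k : ℝ) - 2 = 2 / (k : ℝ) by ring, abs_of_nonneg (by positivity)]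
  have hA : 0 < r ^ (((k + 2 : ℕ) : ℝ) / 2) := by positivity
  have hB : 0 < negSchwarzschild k m r ^ (Nc (k + 2) - 1) := by positivity
  have hS : 0 < √(m / 2) := by positivity
  generalize r ^ (((k + 2 : ℕ) : ℝ) / 2) = A at *
  generalize negSchwarzschild k m r ^ (Nc (k + 2) - 1) = B at *
  generalize negSchwarzschild k m r ^ (1 + 2 / (k : ℝ)) = C at *
  generalize negSchwarzschild k m r ^ (2 / (k : ℝ)) = D at *
  generalize √(m / 2) = S at *
  subst hm2
  push_cast
  have hp : (2 : ℝ) + 2 / k ≠ 0 := by positivity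
  field_simp
  ring

/-- For the negative mass Schwarzschild conformal factor
`φ(r) = 1 − m/(2r^{n−2})`, one has `φ > 0`, `φ' > 0` on `(m^{1/(n−2)}, ∞)` and
`lim_{r→∞} r^{n/2} F[φ](r) = n √(m/2)`; i.e. the associated mean curvature
satisfies `|τ(r)| ∼ n√(m/2) · r^{−n/2}`. -/
theorem stmt14 (n : ℕ) (hn : 3 ≤ n) (m : ℝ) (hm : 0 < m) :
    (∀ r : ℝ, m ^ ((1 : ℝ) / ((n : ℝ) - 2)) < r →
      0 < (1 - m / (2 * r ^ (n - 2))) ∧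
      0 < deriv (fun s : ℝ => 1 - m / (2 * s ^ (n - 2))) r) ∧
    Filter.Tendsto
      (fun r : ℝ => r ^ ((n : ℝ) / 2) *
        Ff n (fun s : ℝ => 1 - m / (2 * s ^ (n - 2))) r)
      Filter.atTop (nhds ((n : ℝ) * Real.sqrt (m / 2))) := by
  obtain ⟨k, rfl⟩ : ∃ k, n = k + 2 := ⟨n - 2, by omega⟩
  have hk : k ≠ 0 := by omega
  rw [show k + 2 - 2 = k by omega]
  change (∀ r : ℝ, m ^ ((1 : ℝ) / (((k + 2 : ℕ) : ℝ) - 2)) < r →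
      0 < negSchwarzschild k m r ∧ 0 < deriv (negSchwarzschild k m) r) ∧
    Tendsto (fun r : ℝ => r ^ (((k + 2 : ℕ) : ℝ) / 2) * Ff (k + 2) (negSchwarzschild k m) r)
      atTop (nhds (((k + 2 : ℕ) : ℝ) * √(m / 2)))
  constructor
  · intro r hr
    rw [show ((k + 2 : ℕ) : ℝ) - 2 = k by push_cast; ring, one_div] at hr
    have hr0 : 0 < r := (by positivity : 0 < m ^ ((k : ℝ)⁻¹)).trans hr
    have hmr : m < r ^ k := by
      simpa only [rpow_inv_natCast_pow hm.le hk] using pow_lt_pow_left₀ hr (by positivity) hk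
    refine ⟨negSchwarzschild_pos hr0 (by linarith), ?_⟩
    rw [(hasDerivAt_negSchwarzschild k m hr0.ne').deriv]
    positivity
  · have hlim := tendsto_negSchwarzschild hk m
    have hpow (q : ℝ) : Tendsto (fun r => negSchwarzschild k m r ^ q) atTop (nhds 1) := by
      simpa using hlim.rpow_const (p := q) (Or.inl one_ne_zero)
    have hdiv : Tendsto (fun s : ℝ => m / (2 * s ^ k)) atTop (nhds 0) := by
      simpa [negSchwarzschild] using hlim.const_sub 1
    have hmain := ((((hpow (1 + 2 / (k : ℝ))).const_mul ((k + 2 : ℕ) : ℝ)).add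
      ((hdiv.const_mul ((1 + 2 / (k : ℝ)) * k)).mul (hpow (2 / (k : ℝ))))).const_mul
        √(m / 2)).div (hpow (Nc (k + 2) - 1)) one_ne_zero
    simp only [mul_one, mul_zero, add_zero, div_one] at hmain
    rw [mul_comm √(m / 2)] at hmain
    refine hmain.congr' ?_
    filter_upwards [eventually_gt_atTop 0,
      ((tendsto_pow_atTop hk).const_mul_atTop two_pos).eventually_gt_atTop m] with r hr h
    exact (rpow_mul_Ff_negSchwarzschild hk hm hr h).symm
end
end
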